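/- arXiv:1902.09185 — 6 statements merged into one kernel-verified Lean document; each statement's English description precedes it below -/
import Mathlib

section
/- Let A be an artin algebra, Q an A-module with Ext_A^i(Q, Q) = 0 for all i ≥ 1, and let 0 → X → Q⁰ → Q¹ → ⋯ → Q^n be an exact sequence with each Q^i in add Q, and let X^{i} denote the successive cokernels (X⁰ = X). Then Ext_A^j(X^{n+1}, Q) = 0 for all 1 ≤ j ≤ n+1 if and only if for each 0 ≤ i ≤ n the inclusion X^i → Q^i is a left add Q-approximation (i.e., the map Hom_A(Q^i, Q) → Hom_A(X^i, Q) is surjective). -/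
open CategoryTheory TensorProduct

universe u

/-- The `k`-th Ext group of the `A`-modules `X` and `Y`. -/
noncomputable def ExtGrp (A : Type u) [Ring A] (k : ℕ)
    (X Y : Type u) [AddCommGroup X] [Module A X] [AddCommGroup Y] [Module A Y] : Type u :=
  ((Ext ℤ (ModuleCat.{u} A) k).obj (Opposite.op (ModuleCat.of A X))).obj (ModuleCat.of A Y)

noncomputable instance (A : Type u) [Ring A] (k : ℕ)
    (X Y : Type u) [AddCommGroup X] [Module A X] [AddCommGroup Y] [Module A Y] :
    AddCommGroup (ExtGrp A k X Y) := by
  unfold ExtGrp; infer_instance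

/-- `Ext_A^k(X, Y) = 0`. -/
def ExtZero (A : Type u) [Ring A] (k : ℕ)
    (X Y : Type u) [AddCommGroup X] [Module A X] [AddCommGroup Y] [Module A Y] : Prop :=
  Subsingleton (ExtGrp A k X Y)

/-- `pd X ≤ n`: `Ext^k(X, -)` vanishes for all `k > n`. -/
def ProjDimLE (A : Type u) [Ring A] (X : Type u) [AddCommGroup X] [Module A X] (n : ℕ) : Prop :=
  ∀ k : ℕ, n < k → ∀ Y : ModuleCat.{u} A, ExtZero A k X Y

/-- The projective dimension of `X`, the length of a shortest projective resolution,
as an element of `ℕ∞` (`⊤` if infinite). -/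
noncomputable def projDim (A : Type u) [Ring A] (X : Type u) [AddCommGroup X] [Module A X] : ℕ∞ :=
  sInf ((fun n : ℕ => (n : ℕ∞)) '' {n : ℕ | ProjDimLE A X n})

/-- `id Y ≤ n`: `Ext^k(-, Y)` vanishes for all `k > n`. -/
def InjDimLE (A : Type u) [Ring A] (Y : Type u) [AddCommGroup Y] [Module A Y] (n : ℕ) : Prop :=
  ∀ k : ℕ, n < k → ∀ X : ModuleCat.{u} A, ExtZero A k X Y

/-- The injective dimension of `Y`, as an element of `ℕ∞` (`⊤` if infinite). -/
noncomputable def injDim (A : Type u) [Ring A] (Y : Type u) [AddCommGroup Y] [Module A Y] : ℕ∞ :=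
  sInf ((fun n : ℕ => (n : ℕ∞)) '' {n : ℕ | InjDimLE A Y n})

/-- `X ∈ add Q`: `X` is a direct summand of a finite direct sum of copies of `Q`. -/
def InAdd (A : Type u) [Ring A] (Q : Type u) [AddCommGroup Q] [Module A Q]
    (X : Type u) [AddCommGroup X] [Module A X] : Prop :=
  ∃ (n : ℕ) (Y : ModuleCat.{u} A), Nonempty ((X × Y) ≃ₗ[A] (Fin n → Q))

theorem stmt4_extZero_iff (A : Type u) [Ring A] (k : ℕ) (X Y : ModuleCat.{u} A) :
    ExtZero A (k + 1) X Y ↔ Subsingleton (Abelian.Ext.{u} X Y (k + 1)) := by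
  let P := projectiveResolution X
  have h1 : Subsingleton (Abelian.Ext.{u} X Y (k + 1)) ↔
      ∀ f : P.complex.X (k+1) ⟶ Y, P.complex.d (k+2) (k+1) ≫ f = 0 →
        ∃ g : P.complex.X k ⟶ Y, P.complex.d (k+1) k ≫ g = f := by
    constructor
    · intro h f hf
      exact (P.extMk_eq_zero_iff f (k+2) rfl hf k rfl).1 (Subsingleton.elim _ _)
    · intro h
      refine subsingleton_of_forall_eq 0 fun e => ?_
      obtain ⟨f, hf, rfl⟩ := P.extMk_surjective e (k+2) rfl
      exact (P.extMk_eq_zero_iff f (k+2) rfl hf k rfl).2 (h f hf)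
  rw [h1]
  have h2 : ExtZero A (k + 1) X Y ↔ (P.complex.linearYonedaObj ℤ Y).ExactAt (k+1) := by
    rw [HomologicalComplex.exactAt_iff_isZero_homology,
      ← (P.isoExt (R := ℤ) (k+1) Y).isZero_iff]
    exact ModuleCat.isZero_iff_subsingleton.symm
  rw [h2, HomologicalComplex.exactAt_iff' _ k (k+1) (k+2) (by simp) (by simp),
    ShortComplex.moduleCat_exact_iff]
  rfl

theorem stmt4_add {A : Type u} [Ring A] (Q : Type u) [AddCommGroup Q] [Module A Q]
    (k : ℕ) (hQ : Subsingleton (Abelian.Ext.{u} (ModuleCat.of A Q) (ModuleCat.of A Q) k))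
    (X : ModuleCat.{u} A) (hX : InAdd A Q X) :
    Subsingleton (Abelian.Ext.{u} X (ModuleCat.of A Q) k) := by
  obtain ⟨n, Y, ⟨e⟩⟩ := hX
  refine subsingleton_of_forall_eq 0 fun x => ?_
  let a : Fin n → (X ⟶ ModuleCat.of A Q) := fun i =>
    ModuleCat.ofHom (LinearMap.proj i ∘ₗ e.toLinearMap ∘ₗ LinearMap.inl A X Y)
  let b : Fin n → (ModuleCat.of A Q ⟶ X) := fun i =>
    ModuleCat.ofHom (LinearMap.fst A X Y ∘ₗ e.symm.toLinearMap ∘ₗ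
      LinearMap.single A (fun _ => Q) i)
  have hid : 𝟙 X = ∑ i, a i ≫ b i := by
    ext t
    have : ∑ i, Pi.single i (e (t, 0) i) = e (t, (0 : Y)) :=
      Finset.univ_sum_single (e (t, (0 : Y)))
    have h2 := congrArg (fun z => (e.symm z).1) this
    simp only [map_sum, LinearEquiv.symm_apply_apply, Prod.fst_sum] at h2
    simp only [ModuleCat.hom_sum, LinearMap.sum_apply]
    exact h2.symm
  have key : (Abelian.Ext.mk₀ (∑ i, a i ≫ b i)).comp x (zero_add k) = 0 := by
    refine Finset.sum_induction (fun i => a i ≫ b i)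
      (fun f => (Abelian.Ext.mk₀ f).comp x (zero_add k) = 0) ?_ ?_ ?_
    · intro f g hf hg
      simp only [Abelian.Ext.mk₀_add, Abelian.Ext.add_comp, hf, hg, add_zero]
    · simp
    · intro i _
      rw [← Abelian.Ext.mk₀_comp_mk₀_assoc,
        Subsingleton.elim ((Abelian.Ext.mk₀ (b i)).comp x (zero_add k)) 0,
        Abelian.Ext.comp_zero]
  rwa [← hid, Abelian.Ext.mk₀_id_comp] at key

theorem stmt4_shift {A : Type u} [Ring A] {S : ShortComplex (ModuleCat.{u} A)}
    (hS : S.ShortExact) (Q : ModuleCat.{u} A)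
    (h2 : ∀ k, Subsingleton (Abelian.Ext.{u} S.X₂ Q (k+1))) (k : ℕ) :
    Subsingleton (Abelian.Ext.{u} S.X₃ Q (k+2)) ↔
      Subsingleton (Abelian.Ext.{u} S.X₁ Q (k+1)) := by
  constructor
  · intro h
    refine subsingleton_of_forall_eq 0 fun x => ?_
    obtain ⟨y, rfl⟩ := Abelian.Ext.contravariant_sequence_exact₁ hS Q x
      (show 1 + (k+1) = k+2 by omega) (Subsingleton.elim _ _)
    rw [(h2 k).elim y 0, Abelian.Ext.comp_zero]
  · intro h
    refine subsingleton_of_forall_eq 0 fun x => ?_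
    obtain ⟨y, rfl⟩ := Abelian.Ext.contravariant_sequence_exact₃ hS Q x
      ((h2 (k+1)).elim _ _) (show 1 + (k+1) = k+2 by omega)
    rw [h.elim y 0, Abelian.Ext.comp_zero]

theorem stmt4_one {A : Type u} [Ring A] {S : ShortComplex (ModuleCat.{u} A)}
    (hS : S.ShortExact) (Q : ModuleCat.{u} A)
    (h2 : Subsingleton (Abelian.Ext.{u} S.X₂ Q 1)) :
    Subsingleton (Abelian.Ext.{u} S.X₃ Q 1) ↔
      ∀ φ : S.X₁ ⟶ Q, ∃ ψ : S.X₂ ⟶ Q, S.f ≫ ψ = φ := by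
  constructor
  · intro h φ
    obtain ⟨y, hy⟩ := Abelian.Ext.contravariant_sequence_exact₁ hS Q (Abelian.Ext.mk₀ φ)
      (show 1 + 0 = 1 by omega) (Subsingleton.elim _ _)
    obtain ⟨ψ, rfl⟩ := (Abelian.Ext.mk₀_bijective _ _).2 y
    rw [Abelian.Ext.mk₀_comp_mk₀] at hy
    exact ⟨ψ, (Abelian.Ext.mk₀_bijective _ _).1 hy⟩
  · intro h
    refine subsingleton_of_forall_eq 0 fun x => ?_
    obtain ⟨y, rfl⟩ := Abelian.Ext.contravariant_sequence_exact₃ hS Q x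
      (h2.elim _ _) (show 1 + 0 = 1 by omega)
    obtain ⟨φ, rfl⟩ := (Abelian.Ext.mk₀_bijective _ _).2 y
    obtain ⟨ψ, rfl⟩ := h φ
    rw [← Abelian.Ext.mk₀_comp_mk₀ , ShortComplex.ShortExact.extClass_comp_assoc]

/-- Let `A` be an artin algebra, `Q` a module with `Ext^i(Q,Q) = 0` for all
`i ≥ 1`, and `0 → X → Q⁰ → ⋯ → Qⁿ` an exact sequence with each `Q^i ∈ add Q`, encoded via the
short exact sequences `0 → X^i → Q^i → X^{i+1} → 0` on the successive cokernels (`X⁰ = X`).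
Then `Ext^j(X^{n+1}, Q) = 0` for all `1 ≤ j ≤ n+1` iff each inclusion `X^i → Q^i` is a left
`add Q`-approximation, i.e. `Hom(Q^i, Q) → Hom(X^i, Q)` is surjective. -/
theorem stmt4 (R₀ : Type u) [CommRing R₀] [IsArtinianRing R₀]
    (A : Type u) [Ring A] [Algebra R₀ A] [Module.Finite R₀ A]
    (Q : Type u) [AddCommGroup Q] [Module A Q]
    (hQ : ∀ i : ℕ, 1 ≤ i → ExtZero A i Q Q)
    (n : ℕ) (Xs : Fin (n + 2) → ModuleCat.{u} A) (Qs : Fin (n + 1) → ModuleCat.{u} A)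
    (hQs : ∀ i, InAdd A Q (Qs i))
    (f : ∀ i : Fin (n + 1), ↥(Xs i.castSucc) →ₗ[A] ↥(Qs i))
    (g : ∀ i : Fin (n + 1), ↥(Qs i) →ₗ[A] ↥(Xs i.succ))
    (hmono : ∀ i, Function.Injective (f i))
    (hepi : ∀ i, Function.Surjective (g i))
    (hexact : ∀ i, Function.Exact (f i) (g i)) :
    (∀ j : ℕ, 1 ≤ j → j ≤ n + 1 → ExtZero A j (Xs (Fin.last (n + 1))) Q) ↔
      (∀ i : Fin (n + 1), ∀ φ : ↥(Xs i.castSucc) →ₗ[A] Q,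
        ∃ ψ : ↥(Qs i) →ₗ[A] Q, ψ ∘ₗ f i = φ) := by
  let Q' : ModuleCat.{u} A := ModuleCat.of A Q
  let S : Fin (n+1) → ShortComplex (ModuleCat.{u} A) := fun i =>
    ShortComplex.mk (ModuleCat.ofHom (f i)) (ModuleCat.ofHom (g i)) (by
      ext x
      exact (hexact i).apply_apply_eq_zero x)
  have hS : ∀ i, (S i).ShortExact := fun i =>
    { exact := (ShortComplex.ShortExact.moduleCat_exact_iff_function_exact _).2 (hexact i)
      mono_f := (ModuleCat.mono_iff_injective _).2 (hmono i)
      epi_g := (ModuleCat.epi_iff_surjective _).2 (hepi i) }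
  have h2 : ∀ i k, Subsingleton (Abelian.Ext.{u} (S i).X₂ Q' (k+1)) := fun i k =>
    stmt4_add Q (k+1) ((stmt4_extZero_iff A k Q' Q').1 (hQ (k+1) (by omega))) _ (hQs i)
  have shift : ∀ (m i : ℕ) (h : i + 1 + m < n + 2),
      Subsingleton (Abelian.Ext.{u} (Xs ⟨i + 1 + m, h⟩) Q' (m+1)) ↔
        Subsingleton (Abelian.Ext.{u} (Xs ⟨i + 1, by omega⟩) Q' 1) := by
    intro m
    induction m with
    | zero => intro i h; exact Iff.rfl
    | succ m ih =>
      intro i h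
      rw [← ih i (by omega)]
      exact stmt4_shift (hS ⟨i + 1 + m, by omega⟩) Q' (h2 _) m
  have one : ∀ i : Fin (n+1), Subsingleton (Abelian.Ext.{u} (Xs i.succ) Q' 1) ↔
      ∀ φ : ↥(Xs i.castSucc) →ₗ[A] Q, ∃ ψ : ↥(Qs i) →ₗ[A] Q, ψ ∘ₗ f i = φ := by
    intro i
    refine (stmt4_one (hS i) Q' (h2 i 0)).trans ⟨fun h φ => ?_, fun h φ => ?_⟩
    · obtain ⟨ψ, hψ⟩ := h (ModuleCat.ofHom φ)
      exact ⟨ψ.hom, congrArg ModuleCat.Hom.hom hψ⟩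
    · obtain ⟨ψ, hψ⟩ := h φ.hom
      exact ⟨ModuleCat.ofHom ψ, ModuleCat.hom_ext hψ⟩
  constructor
  · intro h i
    rw [← one i]
    obtain ⟨i, hi⟩ := i
    have := shift (n - i) i (by omega)
    refine this.1 ((stmt4_extZero_iff A (n - i) _ Q').1 ?_)
    have e : (⟨i + 1 + (n - i), by omega⟩ : Fin (n+2)) = Fin.last (n+1) := by
      ext; simp; omega
    rw [e]
    exact h _ (by omega) (by omega)
  · intro h j h1 hj
    obtain ⟨m, rfl⟩ : ∃ m, j = m + 1 := ⟨j - 1, by omega⟩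
    refine (stmt4_extZero_iff A m _ Q').2 ?_
    have := (shift m (n - m) (by omega)).2 ((one ⟨n - m, by omega⟩).2 (h _))
    have e : (⟨n - m + 1 + m, by omega⟩ : Fin (n+2)) = Fin.last (n+1) := by
      ext; simp; omega
    rwa [e] at this
end

section
/- Let A be an artin algebra and T an A-module with finite projective dimension and Ext_A^i(T, T) = 0 for all i ≥ 1. Then T is a tilting module (i.e., there is an exact sequence 0 → A → T⁰ → ⋯ → T^m → 0 with all T^i in add T) if and only if the minimal length of such a coresolution of A by modules in add T equals the projective dimension of T. -/
open CategoryTheory TensorProduct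

universe u

/-- `M` has an exact coresolution `0 → M → T⁰ → ⋯ → T^m → 0` with all `T^i ∈ add T`,
encoded by short exact sequences `0 → K_i → T^i → K_{i+1} → 0` with `K_0 ≅ M` and
`K_{m+1} = 0`. -/
def HasAddCoresolution (A : Type u) [Ring A] (T : Type u) [AddCommGroup T] [Module A T]
    (M : Type u) [AddCommGroup M] [Module A M] (m : ℕ) : Prop :=
  ∃ (K : Fin (m + 2) → ModuleCat.{u} A) (Ts : Fin (m + 1) → ModuleCat.{u} A)
    (f : ∀ i : Fin (m + 1), ↥(K i.castSucc) →ₗ[A] ↥(Ts i))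
    (g : ∀ i : Fin (m + 1), ↥(Ts i) →ₗ[A] ↥(K i.succ)),
    Nonempty (M ≃ₗ[A] K 0) ∧ Subsingleton (K (Fin.last (m + 1))) ∧
    (∀ i, InAdd A T (Ts i)) ∧
    (∀ i, Function.Injective (f i)) ∧ (∀ i, Function.Surjective (g i)) ∧
    (∀ i, Function.Exact (f i) (g i))

/-- The `T`-codimension of `M`: the minimal length of an exact coresolution of `M` by
modules in `add T`, as an element of `ℕ∞` (`⊤` if none exists). -/
noncomputable def codim (A : Type u) [Ring A] (T : Type u) [AddCommGroup T] [Module A T]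
    (M : Type u) [AddCommGroup M] [Module A M] : ℕ∞ :=
  sInf ((fun m : ℕ => (m : ℕ∞)) '' {m : ℕ | HasAddCoresolution A T M m})

open Abelian in
theorem extZero_iff_res {A : Type u} [Ring A] {X : ModuleCat.{u} A} (P : ProjectiveResolution X)
    (Y : ModuleCat.{u} A) (p : ℕ) :
    ExtZero A (p+1) X Y ↔ ∀ f : P.complex.X (p+1) ⟶ Y, P.complex.d (p+2) (p+1) ≫ f = 0 →
      ∃ g : P.complex.X p ⟶ Y, P.complex.d (p+1) p ≫ g = f := by
  have e : ExtGrp A (p+1) X Y ≃ ((P.complex.linearYonedaObj ℤ Y).homology (p+1)) :=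
    ((P.isoExt (R := ℤ) (p+1) Y).toLinearEquiv).toEquiv
  unfold ExtZero
  rw [e.subsingleton_congr, ← ModuleCat.isZero_of_iff_subsingleton (R := ℤ)]
  rw [← HomologicalComplex.exactAt_iff_isZero_homology,
    HomologicalComplex.exactAt_iff' _ p (p+1) (p+2) (by simp) (by simp),
    ShortComplex.moduleCat_exact_iff]
  rfl

open Abelian in
theorem subsingleton_ext_iff_res {A : Type u} [Ring A] {X : ModuleCat.{u} A}
    (P : ProjectiveResolution X) (Y : ModuleCat.{u} A) (p : ℕ) :
    Subsingleton (Abelian.Ext X Y (p+1)) ↔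
      ∀ f : P.complex.X (p+1) ⟶ Y, P.complex.d (p+2) (p+1) ≫ f = 0 →
      ∃ g : P.complex.X p ⟶ Y, P.complex.d (p+1) p ≫ g = f := by
  constructor
  · intro h f hf
    exact (P.extMk_eq_zero_iff f (p+2) rfl hf p rfl).1 (Subsingleton.elim _ _)
  · intro h
    refine subsingleton_of_forall_eq 0 fun α => ?_
    obtain ⟨f, hf, rfl⟩ := P.extMk_surjective α (p+2) rfl
    exact (P.extMk_eq_zero_iff f (p+2) rfl hf p rfl).2 (h f hf)

theorem extZero_iff {A : Type u} [Ring A] (X Y : ModuleCat.{u} A) (k : ℕ) (hk : 1 ≤ k) :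
    ExtZero A k X Y ↔ Subsingleton (Abelian.Ext X Y k) := by
  obtain ⟨p, rfl⟩ : ∃ p, k = p + 1 := ⟨k - 1, by omega⟩
  rw [extZero_iff_res (projectiveResolution X), subsingleton_ext_iff_res (projectiveResolution X)]

/-- products -/
theorem ext_pi {A : Type u} [Ring A] (X : ModuleCat.{u} A) (ι : Type u) (Y : Type u)
    [AddCommGroup Y] [Module A Y] (k : ℕ) (hk : 1 ≤ k)
    (h : Subsingleton (Abelian.Ext X (ModuleCat.of A Y) k)) :
    Subsingleton (Abelian.Ext X (ModuleCat.of A (ι → Y)) k) := by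
  obtain ⟨p, rfl⟩ : ∃ p, k = p + 1 := ⟨k - 1, by omega⟩
  rw [subsingleton_ext_iff_res (projectiveResolution X)] at h ⊢
  intro f hf
  choose g hg using fun i : ι => h (f ≫ ModuleCat.ofHom (LinearMap.proj i)) (by
    rw [← Category.assoc, hf, Limits.zero_comp])
  refine ⟨ModuleCat.ofHom (LinearMap.pi fun i => (g i).hom), ?_⟩
  ext x i
  exact ConcreteCategory.congr_hom (hg i) x

theorem ext_retract {A : Type u} [Ring A] (X Y Z : ModuleCat.{u} A) (k : ℕ)
    (i : Y ⟶ Z) (r : Z ⟶ Y) (hir : i ≫ r = 𝟙 Y)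
    (h : Subsingleton (Abelian.Ext X Z k)) :
    Subsingleton (Abelian.Ext X Y k) := by
  refine subsingleton_of_forall_eq 0 fun α => ?_
  have h1 : α.comp (Abelian.Ext.mk₀ (i ≫ r)) (add_zero k) = α := by simp [hir]
  rw [← Abelian.Ext.mk₀_comp_mk₀, ← Abelian.Ext.comp_assoc_of_second_deg_zero,
    Subsingleton.elim (α.comp (Abelian.Ext.mk₀ i) (add_zero k)) 0, Abelian.Ext.zero_comp] at h1
  exact h1.symm


/-- The short complex of an exact sequence of linear maps. -/
abbrev sesC {A : Type u} [Ring A] {K L M : ModuleCat.{u} A} (f : K →ₗ[A] L) (g : L →ₗ[A] M)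
    (h : Function.Exact f g) : ShortComplex (ModuleCat.{u} A) :=
  ShortComplex.mk (ModuleCat.ofHom f) (ModuleCat.ofHom g)
    (by ext x; exact h.apply_apply_eq_zero x)

theorem sesC_exact {A : Type u} [Ring A] {K L M : ModuleCat.{u} A} (f : K →ₗ[A] L)
    (g : L →ₗ[A] M) (hf : Function.Injective f) (hg : Function.Surjective g)
    (h : Function.Exact f g) : (sesC f g h).ShortExact := by
  have : Mono (sesC f g h).f := (ModuleCat.mono_iff_injective _).2 hf
  have : Epi (sesC f g h).g := (ModuleCat.epi_iff_surjective _).2 hg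
  exact ⟨ShortComplex.ShortExact.moduleCat_exact_iff_function_exact _ |>.2 h⟩

theorem ext_left {A : Type u} [Ring A] (X : ModuleCat.{u} A) {K L M : ModuleCat.{u} A} (f : K →ₗ[A] L)
    (g : L →ₗ[A] M) (hf : Function.Injective f) (hg : Function.Surjective g)
    (h : Function.Exact f g) (k : ℕ)
    (h2 : Subsingleton (Abelian.Ext X L (k+1))) (h3 : Subsingleton (Abelian.Ext X M k)) :
    Subsingleton (Abelian.Ext X K (k+1)) := by
  refine subsingleton_of_forall_eq 0 fun α => ?_
  obtain ⟨x, hx⟩ := Abelian.Ext.covariant_sequence_exact₁ (hS := sesC_exact f g hf hg h) X α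
    (Subsingleton.elim _ _) rfl
  rw [← hx, Subsingleton.elim x 0, Abelian.Ext.zero_comp]

theorem ext_mid {A : Type u} [Ring A] (X : ModuleCat.{u} A) {K L M : ModuleCat.{u} A} (f : K →ₗ[A] L)
    (g : L →ₗ[A] M) (hf : Function.Injective f) (hg : Function.Surjective g)
    (h : Function.Exact f g) (k : ℕ)
    (h1 : Subsingleton (Abelian.Ext X K k)) (h3 : Subsingleton (Abelian.Ext X M k)) :
    Subsingleton (Abelian.Ext X L k) := by
  refine subsingleton_of_forall_eq 0 fun α => ?_
  obtain ⟨x, hx⟩ := Abelian.Ext.covariant_sequence_exact₂ (hS := sesC_exact f g hf hg h) X α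
    (Subsingleton.elim _ _)
  rw [← hx, Subsingleton.elim x 0, Abelian.Ext.zero_comp]

theorem ext_right {A : Type u} [Ring A] (X : ModuleCat.{u} A) {K L M : ModuleCat.{u} A} (f : K →ₗ[A] L)
    (g : L →ₗ[A] M) (hf : Function.Injective f) (hg : Function.Surjective g)
    (h : Function.Exact f g) (k : ℕ)
    (h1 : Subsingleton (Abelian.Ext X K (k+1)))
    (h2 : Subsingleton (Abelian.Ext X L k)) :
    Subsingleton (Abelian.Ext X M k) := by
  refine subsingleton_of_forall_eq 0 fun α => ?_
  obtain ⟨x, hx⟩ := Abelian.Ext.covariant_sequence_exact₃ (hS := sesC_exact f g hf hg h) X α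
    rfl (Subsingleton.elim _ _)
  rw [← hx, Subsingleton.elim x 0, Abelian.Ext.zero_comp]

theorem ext_lift {A : Type u} [Ring A] (X : ModuleCat.{u} A) {K L M : ModuleCat.{u} A} (f : K →ₗ[A] L)
    (g : L →ₗ[A] M) (hf : Function.Injective f) (hg : Function.Surjective g)
    (h : Function.Exact f g)
    (h1 : Subsingleton (Abelian.Ext X K 1)) (φ : X →ₗ[A] M) :
    ∃ ψ : X →ₗ[A] L, g ∘ₗ ψ = φ := by
  obtain ⟨x, hx⟩ := Abelian.Ext.covariant_sequence_exact₃ (hS := sesC_exact f g hf hg h) X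
    (Abelian.Ext.mk₀ (ModuleCat.ofHom φ)) rfl (Subsingleton.elim _ _)
  obtain ⟨ψ, rfl⟩ := Abelian.Ext.mk₀_bijective _ _ |>.2 x
  rw [Abelian.Ext.mk₀_comp_mk₀] at hx
  have := (Abelian.Ext.mk₀_bijective _ _).1 hx
  exact ⟨ψ.hom, congrArg ModuleCat.Hom.hom this⟩

theorem semisimple_of_torsion {A : Type u} [Ring A] [IsSemiprimaryRing A] (M : Type u)
    [AddCommGroup M] [Module A M] (h : Module.IsTorsionBySet A M (Ring.jacobson A)) :
    IsSemisimpleModule A M := by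
  let _ := h.module
  exact (h.semilinearMap.isSemisimpleModule_iff_of_bijective Function.bijective_id).2
      inferInstance

theorem retract_pi {A : Type u} [Ring A] [IsSemiprimaryRing A] (M : Type u)
    [AddCommGroup M] [Module A M] (h : Module.IsTorsionBySet A M (Ring.jacobson A)) :
    ∃ (i : M →ₗ[A] (M → A ⧸ Ring.jacobson A)) (r : (M → A ⧸ Ring.jacobson A) →ₗ[A] M),
      r ∘ₗ i = LinearMap.id := by
  have hB : Module.IsTorsionBySet A (A ⧸ Ring.jacobson A) (Ring.jacobson A) := by
    rw [Module.isTorsionBySet_quotient_iff]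
    intro x r hr
    exact Ideal.mul_mem_right _ _ hr
  have := semisimple_of_torsion _ hB
  have : IsSemisimpleModule A (M → A ⧸ Ring.jacobson A) := by
    refine semisimple_of_torsion _ ?_
    intro x a
    ext i
    exact @hB (x i) a
  let π : (M →₀ A ⧸ Ring.jacobson A) →ₗ[A] M := Finsupp.lsum ℕ fun m =>
    Submodule.liftQ _ (LinearMap.toSpanSingleton A M m) (fun a ha => @h m ⟨a, ha⟩)
  have hπ : Function.Surjective π := fun m => ⟨Finsupp.single m (Submodule.Quotient.mk 1), by
    simp only [π, Finsupp.lsum_single]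
    exact one_smul A m⟩
  obtain ⟨s, hs⟩ := IsSemisimpleModule.lifting_property π hπ LinearMap.id
  let i : M →ₗ[A] (M → A ⧸ Ring.jacobson A) := Finsupp.lcoeFun ∘ₗ s
  have hi : Function.Injective i :=
    DFunLike.coe_injective.comp
      (Function.LeftInverse.injective (g := π) (fun x => LinearMap.congr_fun hs x))
  obtain ⟨r, hr⟩ := IsSemisimpleModule.extension_property i hi LinearMap.id
  exact ⟨i, r, hr⟩

theorem ext_all {A : Type u} [Ring A] [IsSemiprimaryRing A] (X : ModuleCat.{u} A) (k : ℕ)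
    (hk : 1 ≤ k)
    (htop : ∀ Y : ModuleCat.{u} A, Subsingleton (Abelian.Ext X Y (k+1)))
    (hA : Subsingleton (Abelian.Ext X (ModuleCat.of A A) k)) (Y : Type u) [AddCommGroup Y]
    [Module A Y] :
    Subsingleton (Abelian.Ext X (ModuleCat.of A Y) k) := by
  refine IsSemiprimaryRing.induction A A Y (P := fun (M : Type u) _ _ _ =>
    Subsingleton (Abelian.Ext X (ModuleCat.of A M) k)) ?_ ?_
  · intro M _ _ _ _ _ hM
    obtain ⟨i, r, hir⟩ := retract_pi M hM
    refine ext_retract X _ (ModuleCat.of A (M → A ⧸ Ring.jacobson A)) k (ModuleCat.ofHom i)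
      (ModuleCat.ofHom r) (by ext x; exact LinearMap.congr_fun hir x) ?_
    refine ext_pi X M _ k hk ?_
    exact ext_right X (K := ModuleCat.of A (Ring.jacobson A)) (L := ModuleCat.of A A)
      (M := ModuleCat.of A (A ⧸ Ring.jacobson A))
      (Submodule.subtype _) (Submodule.mkQ _) (Submodule.subtype_injective _)
      (Submodule.mkQ_surjective _) (LinearMap.exact_subtype_mkQ _) k (htop _) hA
  · intro M _ _ _ _ N h1 h2
    exact ext_mid X (K := ModuleCat.of A N) (L := ModuleCat.of A M)
      (M := ModuleCat.of A (M ⧸ N))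
      (Submodule.subtype _) (Submodule.mkQ _) (Submodule.subtype_injective _)
      (Submodule.mkQ_surjective _) (LinearMap.exact_subtype_mkQ _) k h1 h2

theorem inAdd_of_retract {A : Type u} [Ring A] {T : Type u} [AddCommGroup T] [Module A T]
    {X Y : Type u} [AddCommGroup X] [Module A X] [AddCommGroup Y] [Module A Y]
    (i : X →ₗ[A] Y) (r : Y →ₗ[A] X) (hir : r ∘ₗ i = LinearMap.id) (hY : InAdd A T Y) :
    InAdd A T X := by
  obtain ⟨n, Z, ⟨e⟩⟩ := hY
  have hl : ∀ x, r (i x) = x := fun x => LinearMap.congr_fun hir x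
  refine ⟨n, ModuleCat.of A (LinearMap.ker r × Z), ⟨?_⟩⟩
  let e' : (X × (LinearMap.ker r × Z)) ≃ₗ[A] (Y × Z) :=
    { toFun := fun p => (i p.1 + (p.2.1 : Y), p.2.2)
      invFun := fun q => (r q.1, (⟨q.1 - i (r q.1), by simp [hl]⟩, q.2))
      map_add' := fun p q => by
        ext
        · simp; abel
        · simp
      map_smul' := fun a p => by ext <;> simp
      left_inv := fun p => by
        have h0 : r (p.2.1 : Y) = 0 := p.2.1.2
        ext <;> simp [hl, h0]
      right_inv := fun q => by ext <;> simp }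
  exact e'.trans e

/-- Recursive version of coresolutions. -/
def HC (A : Type u) [Ring A] (T : Type u) [AddCommGroup T] [Module A T] :
    ℕ → ModuleCat.{u} A → Prop
  | 0, M => InAdd A T M
  | m + 1, M => ∃ (X N : ModuleCat.{u} A) (f : M →ₗ[A] X) (g : X →ₗ[A] N),
      InAdd A T X ∧ Function.Injective f ∧ Function.Surjective g ∧ Function.Exact f g ∧ HC A T m N

section
variable {A : Type u} [Ring A] {T : Type u} [AddCommGroup T] [Module A T]

theorem HC_of_cores (m : ℕ) (M : ModuleCat.{u} A) (h : HasAddCoresolution A T M m) :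
    HC A T m M := by
  induction m generalizing M with
  | zero =>
    obtain ⟨K, Ts, f, g, ⟨e⟩, hK, hT, hf, hg, hfg⟩ := h
    have hs : Function.Surjective (f 0) := fun y =>
      (hfg 0 y).1 (@Subsingleton.elim _ hK _ _)
    let e' : M ≃ₗ[A] Ts 0 := e.trans (LinearEquiv.ofBijective (f 0) ⟨hf 0, hs⟩)
    exact inAdd_of_retract e'.toLinearMap e'.symm.toLinearMap (by simp) (hT 0)
  | succ m ih =>
    obtain ⟨K, Ts, f, g, ⟨e⟩, hK, hT, hf, hg, hfg⟩ := h
    refine ⟨Ts 0, K 1, f 0 ∘ₗ e.toLinearMap, g 0, hT 0, (hf 0).comp e.injective, hg 0, ?_, ih _ ?_⟩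
    · intro y
      refine Iff.trans (hfg 0 y) ?_
      constructor
      · rintro ⟨x, rfl⟩
        exact ⟨e.symm x, congrArg (f 0) (e.apply_symm_apply x)⟩
      · rintro ⟨x, rfl⟩
        exact ⟨e x, rfl⟩
    · exact ⟨fun i => K i.succ, fun i => Ts i.succ, fun i => f i.succ, fun i => g i.succ,
        ⟨LinearEquiv.refl A _⟩, hK, fun i => hT i.succ, fun i => hf i.succ, fun i => hg i.succ,
        fun i => hfg i.succ⟩

theorem cores_of_HC (m : ℕ) (M : ModuleCat.{u} A) (h : HC A T m M) :
    HasAddCoresolution A T M m := by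
  suffices h' : ∃ (K : Fin (m + 2) → ModuleCat.{u} A) (Ts : Fin (m + 1) → ModuleCat.{u} A)
    (f : ∀ i : Fin (m + 1), ↥(K i.castSucc) →ₗ[A] ↥(Ts i))
    (g : ∀ i : Fin (m + 1), ↥(Ts i) →ₗ[A] ↥(K i.succ)),
    M = K 0 ∧ Subsingleton (K (Fin.last (m + 1))) ∧
    (∀ i, InAdd A T (Ts i)) ∧
    (∀ i, Function.Injective (f i)) ∧ (∀ i, Function.Surjective (g i)) ∧
    (∀ i, Function.Exact (f i) (g i)) by
    obtain ⟨K, Ts, f, g, rfl, h2⟩ := h'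
    exact ⟨K, Ts, f, g, ⟨LinearEquiv.refl A _⟩, h2⟩
  induction m generalizing M with
  | zero =>
    refine ⟨Fin.cons M (fun _ => ModuleCat.of A PUnit.{u+1}), fun _ => M,
      fun i => Fin.cases (LinearMap.id : M →ₗ[A] M) (fun j => j.elim0) i,
      fun i => (0 : M →ₗ[A] PUnit.{u+1}), rfl, inferInstanceAs (Subsingleton PUnit.{u+1}), fun _ => h,
      ?_, ?_, ?_⟩
    · intro i
      obtain rfl : i = 0 := by omega
      exact Function.injective_id
    · intro i y
      exact ⟨0, @Subsingleton.elim _ (inferInstanceAs (Subsingleton PUnit.{u+1})) _ _⟩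
    · intro i
      obtain rfl : i = 0 := by omega
      intro y
      exact ⟨fun _ => ⟨y, rfl⟩, fun _ => rfl⟩
  | succ m ih =>
    obtain ⟨X, N, f0, g0, hX, hf0, hg0, hfg0, hN⟩ := h
    obtain ⟨K, Ts, f, g, rfl, hK, hT, hf, hg, hfg⟩ := ih N hN
    refine ⟨Fin.cons M K, Fin.cons X Ts, fun i => Fin.cases f0 (fun j => f j) i,
      fun i => Fin.cases g0 (fun j => g j) i, rfl, hK, ?_, ?_, ?_, ?_⟩
    · intro i; exact Fin.cases hX hT i
    · intro i; exact Fin.cases hf0 hf i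
    · intro i; exact Fin.cases hg0 hg i
    · intro i; exact Fin.cases hfg0 hfg i

theorem ext_inAdd (X Y : ModuleCat.{u} A) (hY : InAdd A T Y) (k : ℕ) (hk : 1 ≤ k)
    (h : Subsingleton (Abelian.Ext X (ModuleCat.of A T) k)) :
    Subsingleton (Abelian.Ext X Y k) := by
  obtain ⟨n, Z, ⟨e⟩⟩ := hY
  let e' : (Y × Z) ≃ₗ[A] (ULift.{u} (Fin n) → T) :=
    e.trans (LinearEquiv.funCongrLeft A T Equiv.ulift)
  refine ext_retract X Y (ModuleCat.of A (ULift.{u} (Fin n) → T)) k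
    (ModuleCat.ofHom (e'.toLinearMap ∘ₗ LinearMap.inl A Y Z))
    (ModuleCat.ofHom (LinearMap.fst A Y Z ∘ₗ e'.symm.toLinearMap)) ?_ (ext_pi X _ T k hk h)
  ext x
  simp

theorem lift_inAdd {K L N : ModuleCat.{u} A} (f : K →ₗ[A] L)
    (g : L →ₗ[A] N) (hf : Function.Injective f) (hg : Function.Surjective g)
    (h : Function.Exact f g) (h1 : Subsingleton (Abelian.Ext (ModuleCat.of A T) K 1))
    (hN : InAdd A T N) : ∃ s : N →ₗ[A] L, g ∘ₗ s = LinearMap.id := by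
  obtain ⟨n, Z, ⟨e⟩⟩ := hN
  choose ψ hψ using fun i : Fin n => ext_lift (ModuleCat.of A T) f g hf hg h h1
    (LinearMap.fst A N Z ∘ₗ e.symm.toLinearMap ∘ₗ LinearMap.single A (fun _ => T) i)
  refine ⟨LinearMap.lsum A (fun _ => T) ℕ ψ ∘ₗ e.toLinearMap ∘ₗ LinearMap.inl A N Z, ?_⟩
  have key : g ∘ₗ LinearMap.lsum A (fun _ => T) ℕ ψ = LinearMap.fst A N Z ∘ₗ e.symm.toLinearMap := by
    refine LinearMap.pi_ext' fun i => ?_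
    rw [LinearMap.comp_assoc, LinearMap.comp_assoc, ← hψ i]
    congr 1
    ext x
    simp only [LinearMap.comp_apply, LinearMap.lsum_apply, LinearMap.sum_apply,
      LinearMap.proj_apply, LinearMap.single_apply]
    rw [Finset.sum_eq_single i]
    · simp
    · intro j _ hj
      rw [Pi.single_eq_of_ne hj]
      exact map_zero (ψ j)
    · simp
  rw [← LinearMap.comp_assoc, key]
  ext x
  simp

theorem HC_shorten (hT : ∀ k, 1 ≤ k → Subsingleton (Abelian.Ext (ModuleCat.of A T) (ModuleCat.of A T) k))
    (m : ℕ) (M : ModuleCat.{u} A) (h : HC A T (m+1) M)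
    (h1 : Subsingleton (Abelian.Ext (ModuleCat.of A T) M (m+1))) : HC A T m M := by
  induction m generalizing M with
  | zero =>
    obtain ⟨X, N, f, g, hX, hf, hg, hfg, hN⟩ := h
    obtain ⟨s, hs⟩ := lift_inAdd f g hf hg hfg h1 hN
    have hl : ∀ x, g (s x) = x := fun x => LinearMap.congr_fun hs x
    have hr : ∀ x, x - s (g x) ∈ LinearMap.range f := fun x => by
      rw [LinearMap.mem_range]
      exact (hfg _).1 (by simp [hl])
    let e := LinearEquiv.ofInjective f hf
    refine inAdd_of_retract f
      (e.symm.toLinearMap ∘ₗ (LinearMap.id - s ∘ₗ g).codRestrict (LinearMap.range f) hr) ?_ hX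
    ext x
    apply e.injective
    apply Subtype.ext
    simp [e, hfg.apply_apply_eq_zero]
  | succ m ih =>
    obtain ⟨X, N, f, g, hX, hf, hg, hfg, hN⟩ := h
    refine ⟨X, N, f, g, hX, hf, hg, hfg, ih N hN ?_⟩
    exact ext_right _ f g hf hg hfg (m+1) h1 (ext_inAdd _ X hX (m+1) (by omega) (hT _ (by omega)))

theorem HC_ext (hT : ∀ k, 1 ≤ k → Subsingleton (Abelian.Ext (ModuleCat.of A T) (ModuleCat.of A T) k))
    (m : ℕ) (M : ModuleCat.{u} A) (h : HC A T m M) (k : ℕ) (hk : m < k) :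
    Subsingleton (Abelian.Ext (ModuleCat.of A T) M k) := by
  induction m generalizing M k with
  | zero => exact ext_inAdd _ M h k hk (hT _ hk)
  | succ m ih =>
    obtain ⟨X, N, f, g, hX, hf, hg, hfg, hN⟩ := h
    obtain ⟨k, rfl⟩ : ∃ p, k = p + 1 := ⟨k - 1, by omega⟩
    exact ext_left _ f g hf hg hfg k (ext_inAdd _ X hX (k+1) (by omega) (hT _ (by omega)))
      (ih N hN k (by omega))
end

theorem sInf_coe_spec {S : Set ℕ} (hS : S.Nonempty) :
    ∃ n ∈ S, (∀ k ∈ S, n ≤ k) ∧ sInf ((fun n : ℕ => (n : ℕ∞)) '' S) = n := by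
  classical
  refine ⟨sInf S, Nat.sInf_mem hS, fun k hk => Nat.sInf_le hk, ?_⟩
  apply le_antisymm
  · exact sInf_le ⟨_, Nat.sInf_mem hS, rfl⟩
  · refine le_sInf ?_
    rintro _ ⟨k, hk, rfl⟩
    exact Nat.cast_le.2 (Nat.sInf_le hk)

theorem nonempty_of_sInf {S : Set ℕ} (h : sInf ((fun n : ℕ => (n : ℕ∞)) '' S) ≠ ⊤) :
    S.Nonempty := by
  by_contra hS
  rw [Set.not_nonempty_iff_eq_empty] at hS
  simp [hS] at h

/-- Let `A` be an artin algebra and `T` a module with finite projective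
dimension and `Ext^i(T,T) = 0` for all `i ≥ 1`. Then `T` is a tilting module (i.e. `A`
admits a finite exact coresolution by modules in `add T`) iff `codim_T A = pd T`. -/
theorem stmt6 (R₀ : Type u) [CommRing R₀] [IsArtinianRing R₀]
    (A : Type u) [Ring A] [Algebra R₀ A] [Module.Finite R₀ A]
    (T : Type u) [AddCommGroup T] [Module A T]
    (hpd : projDim A T ≠ ⊤) (hext : ∀ i : ℕ, 1 ≤ i → ExtZero A i T T) :
    (∃ m : ℕ, HasAddCoresolution A T A m) ↔ codim A T A = projDim A T := by
  have : IsArtinianRing A := IsArtinianRing.of_finite R₀ A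
  obtain ⟨n, hn, hmin, hpe⟩ := sInf_coe_spec (nonempty_of_sInf hpd)
  have hT : ∀ k, 1 ≤ k →
      Subsingleton (Abelian.Ext (ModuleCat.of A T) (ModuleCat.of A T) k) := fun k hk =>
    (extZero_iff (ModuleCat.of A T) (ModuleCat.of A T) k hk).1 (hext k hk)
  have hpn : ∀ k, n < k → ∀ Y : ModuleCat.{u} A,
      Subsingleton (Abelian.Ext (ModuleCat.of A T) Y k) := fun k hk Y =>
    (extZero_iff (ModuleCat.of A T) Y k (by omega)).1 (hn k hk Y)
  constructor
  · intro hm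
    obtain ⟨m, hm, hmmin, hce⟩ := sInf_coe_spec hm
    have hHC : HC A T m (ModuleCat.of A A) := HC_of_cores m (ModuleCat.of A A) hm
    have h1 : m ≤ n := by
      by_contra hlt
      obtain ⟨p, rfl⟩ : ∃ p, m = p + 1 := ⟨m - 1, by omega⟩
      have := hmmin p (cores_of_HC p (ModuleCat.of A A)
        (HC_shorten hT p _ hHC (hpn _ (by omega) _)))
      omega
    have h2 : n ≤ m := by
      by_contra hlt
      obtain ⟨p, rfl⟩ : ∃ p, n = p + 1 := ⟨n - 1, by omega⟩
      have hp : ProjDimLE A T p := by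
        intro k hk Y
        rcases Nat.lt_or_ge (p + 1) k with h | h
        · exact hn k h Y
        · obtain rfl : k = p + 1 := by omega
          exact (extZero_iff (ModuleCat.of A T) Y (p + 1) (by omega)).2
            (ext_all (ModuleCat.of A T) (p + 1) (by omega) (hpn _ (by omega))
              (HC_ext hT m _ hHC (p + 1) (by omega)) Y)
      have := hmin p hp
      omega
    have hce' : codim A T A = (m : ℕ∞) := hce
    have hpe' : projDim A T = (n : ℕ∞) := hpe
    rw [hce', hpe', le_antisymm h1 h2]
  · intro h
    rw [← h] at hpd
    exact nonempty_of_sInf hpd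
end

section
/- Let A be an artin algebra and I an injective A-module with projective dimension at most one. Suppose A admits a minimal injective coresolution 0 → A → I⁰ → I¹ → ⋯ with I⁰, …, I^n ∈ add I (i.e., the I-dominant dimension of A is at least n+1). Let A¹ be the cokernel of A → I⁰. Then T := A¹ ⊕ I is a tilting A-module of projective dimension exactly 1, provided A is not injective. -/
open CategoryTheory TensorProduct

universe u

/-- `f : M → I` is an injective hull: `I` is an injective module and `f` is an essential
monomorphism. -/
def IsInjHull (A : Type u) [Ring A] {M I : Type u} [AddCommGroup M] [Module A M]
    [AddCommGroup I] [Module A I] (f : M →ₗ[A] I) : Prop :=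
  Module.Injective A I ∧ Function.Injective f ∧
    ∀ N : Submodule A I, N ≠ ⊥ → N ⊓ LinearMap.range f ≠ ⊥

/-- Comparison of the two versions of `Ext` (vanishing in positive degrees). -/
lemma extZero_iff_s8 (A : Type u) [Ring A] (p : ℕ)
    (X Y : Type u) [AddCommGroup X] [Module A X] [AddCommGroup Y] [Module A Y] :
    ExtZero A (p + 1) X Y ↔
      ∀ e : Abelian.Ext.{u} (ModuleCat.of A X) (ModuleCat.of A Y) (p + 1), e = 0 := by
  let P : ProjectiveResolution (ModuleCat.of A X) := projectiveResolution _
  have h1 : ExtZero A (p + 1) X Y ↔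
      ∀ φ : P.complex.X (p + 1) ⟶ ModuleCat.of A Y, P.complex.d (p + 2) (p + 1) ≫ φ = 0 →
        ∃ ψ : P.complex.X p ⟶ ModuleCat.of A Y, P.complex.d (p + 1) p ≫ ψ = φ := by
    unfold ExtZero ExtGrp
    rw [← ModuleCat.isZero_iff_subsingleton,
      (P.isoExt (R := ℤ) (p + 1) (ModuleCat.of A Y)).isZero_iff,
      ← HomologicalComplex.exactAt_iff_isZero_homology,
      HomologicalComplex.exactAt_iff' _ p (p + 1) (p + 2) (by simp) (by simp),
      ShortComplex.moduleCat_exact_iff]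
    rfl
  rw [h1]
  constructor
  · intro h e
    obtain ⟨φ, hφ, rfl⟩ := P.extMk_surjective e (p + 2) rfl
    exact (P.extMk_eq_zero_iff φ (p + 2) rfl hφ p rfl).2 (h φ hφ)
  · intro h φ hφ
    exact (P.extMk_eq_zero_iff φ (p + 2) rfl hφ p rfl).1 (h _)

lemma projDimLE_iff (A : Type u) [Ring A] (X : Type u) [AddCommGroup X] [Module A X] (n : ℕ) :
    ProjDimLE A X n ↔ HasProjectiveDimensionLT (ModuleCat.of A X) (n + 1) := by
  rw [hasProjectiveDimensionLT_iff.{u}]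
  constructor
  · intro h i hi Y e
    obtain ⟨p, rfl⟩ : ∃ p, i = p + 1 := ⟨i - 1, by omega⟩
    exact (extZero_iff_s8 A p X Y).1 (h (p + 1) hi Y) e
  · intro h i hi Y
    obtain ⟨p, rfl⟩ : ∃ p, i = p + 1 := ⟨i - 1, by omega⟩
    exact (extZero_iff_s8 A p X Y).2 (fun e => h (p + 1) hi e)

lemma projDim_le_iff (A : Type u) [Ring A] (X : Type u) [AddCommGroup X] [Module A X] (n : ℕ) :
    projDim A X ≤ (n : ℕ∞) ↔ ProjDimLE A X n := by
  constructor
  · intro h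
    have hne : ((fun n : ℕ => (n : ℕ∞)) '' {n : ℕ | ProjDimLE A X n}).Nonempty := by
      by_contra hne
      rw [Set.not_nonempty_iff_eq_empty] at hne
      unfold projDim at h
      rw [hne, sInf_empty] at h
      exact absurd h (by simp)
    obtain ⟨m, hm, hm'⟩ := csInf_mem hne
    have hmn : m ≤ n := by
      unfold projDim at h
      rw [← hm'] at h
      exact Nat.cast_le.1 h
    exact fun k hk Y => hm k (lt_of_le_of_lt hmn hk) Y
  · intro h
    exact sInf_le ⟨n, h, rfl⟩

lemma inAdd_pd (A : Type u) [Ring A] (Q : Type u) [AddCommGroup Q] [Module A Q]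
    (X : Type u) [AddCommGroup X] [Module A X] (h : InAdd A Q X) (d : ℕ)
    (hQ : HasProjectiveDimensionLT (ModuleCat.of A Q) d) :
    HasProjectiveDimensionLT (ModuleCat.of A X) d := by
  obtain ⟨n, Y, ⟨e⟩⟩ := h
  have key : ∀ n : ℕ, HasProjectiveDimensionLT (ModuleCat.of A (Fin n → Q)) d := by
    intro n
    induction n with
    | zero =>
      have : HasProjectiveDimensionLT (ModuleCat.of A (Fin 0 → Q)) 0 :=
        Limits.IsZero.hasProjectiveDimensionLT_zero
          (ModuleCat.isZero_of_subsingleton _)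
      exact hasProjectiveDimensionLT_of_ge _ 0 d (by omega)
    | succ n ih =>
      have : HasProjectiveDimensionLT (ModuleCat.of A Q ⊞ ModuleCat.of A (Fin n → Q)) d :=
        inferInstance
      exact hasProjectiveDimensionLT_of_iso
        (ModuleCat.biprodIsoProd (ModuleCat.of A Q) (ModuleCat.of A (Fin n → Q)) ≪≫
          (Fin.consLinearEquiv A (fun _ : Fin (n + 1) => Q)).toModuleIso) d
  have := key n
  let r : Retract (ModuleCat.of A X) (ModuleCat.of A (Fin n → Q)) :=
    { i := ModuleCat.ofHom (e.toLinearMap ∘ₗ LinearMap.inl A X Y)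
      r := ModuleCat.ofHom (LinearMap.fst A X Y ∘ₗ e.symm.toLinearMap)
      retract := by ext x; simp }
  exact r.hasProjectiveDimensionLT d

lemma prod_pd (A : Type u) [Ring A] (X Y : Type u) [AddCommGroup X] [Module A X]
    [AddCommGroup Y] [Module A Y] (d : ℕ)
    (hX : HasProjectiveDimensionLT (ModuleCat.of A X) d)
    (hY : HasProjectiveDimensionLT (ModuleCat.of A Y) d) :
    HasProjectiveDimensionLT (ModuleCat.of A (X × Y)) d :=
  hasProjectiveDimensionLT_of_iso
    (ModuleCat.biprodIsoProd (ModuleCat.of A X) (ModuleCat.of A Y)) d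

lemma main_aux (A : Type u) [Ring A] (hA : ¬ Module.Injective A A)
    (I : Type u) [AddCommGroup I] [Module A I]
    (hIinj : Module.Injective A I) (hIpd : projDim A I ≤ (1 : ℕ∞))
    (J C : ModuleCat.{u} A) (f : A →ₗ[A] J) (g : J →ₗ[A] C)
    (hJ : Module.Injective A J) (hf : Function.Injective f) (hg : Function.Surjective g)
    (hfg : Function.Exact f g) (hJI : InAdd A I J) :
    projDim A (C × I) = (1 : ℕ∞) ∧
      (∀ j : ℕ, 1 ≤ j → ExtZero A j (C × I) (C × I)) ∧
      ∃ m : ℕ, HasAddCoresolution A (C × I) A m := by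
  have hI1 : ProjDimLE A I 1 := (projDim_le_iff A I 1).1 (by exact_mod_cast hIpd)
  have hI2 : HasProjectiveDimensionLT (ModuleCat.of A I) 2 := (projDimLE_iff A I 1).1 hI1
  have hJ2 : HasProjectiveDimensionLT J 2 := inAdd_pd A I J hJI 2 hI2
  let S : ShortComplex (ModuleCat.{u} A) :=
    ShortComplex.mk (X₁ := ModuleCat.of A A) (X₂ := J) (X₃ := C)
      (ModuleCat.ofHom f) (ModuleCat.ofHom g) (by
        exact ModuleCat.hom_ext (LinearMap.ext fun x => hfg.apply_apply_eq_zero x))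
  have hS : S.ShortExact :=
    { exact := (ShortComplex.ShortExact.moduleCat_exact_iff_function_exact S).2 hfg
      mono_f := (ModuleCat.mono_iff_injective _).2 hf
      epi_g := (ModuleCat.epi_iff_surjective _).2 hg }
  have hAproj : Projective (ModuleCat.of A A) :=
    ModuleCat.projective_of_free (Module.Basis.singleton Unit A)
  have hC2 : HasProjectiveDimensionLT C 2 :=
    hS.hasProjectiveDimensionLT_X₃ 1 (inferInstanceAs (HasProjectiveDimensionLT (ModuleCat.of A A) 1)) hJ2
  have hT2 : HasProjectiveDimensionLT (ModuleCat.of A (C × I)) 2 := prod_pd A C I 2 hC2 hI2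
  have hJinj : Injective J := Module.injective_object_of_injective_module A J
  have hIinj' : Injective (ModuleCat.of A I) := Module.injective_object_of_injective_module A I
  refine ⟨?_, ?_, ?_⟩
  · apply le_antisymm
    · exact_mod_cast (projDim_le_iff A (C × I) 1).2 ((projDimLE_iff A (C × I) 1).2 hT2)
    · rw [Order.one_le_iff_ne_zero]
      intro h0
      have h1 : ProjDimLE A (C × I) 0 := (projDim_le_iff A (C × I) 0).1 (by simp [h0])
      have h2 : HasProjectiveDimensionLT (ModuleCat.of A (C × I)) 1 :=
        (projDimLE_iff A (C × I) 0).1 h1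
      let r : Retract C (ModuleCat.of A (C × I)) :=
        { i := ModuleCat.ofHom (LinearMap.inl A C I)
          r := ModuleCat.ofHom (LinearMap.fst A C I)
          retract := by ext x; simp }
      have h3 : HasProjectiveDimensionLT C 1 := r.hasProjectiveDimensionLT 1
      have h4 : Projective S.X₃ := projective_iff_hasProjectiveDimensionLT_one.2 h3
      have sp : S.Splitting := hS.splittingOfProjective
      have hJ' : Injective S.X₂ := hJinj
      have h5 : Injective S.X₁ := ⟨fun {X Y} a b _ =>
        ⟨Injective.factorThru (a ≫ S.f) b ≫ sp.r, by
          rw [← Category.assoc, Injective.comp_factorThru, Category.assoc, sp.f_r,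
            Category.comp_id]⟩⟩
      have h6 : Injective (ModuleCat.of A A) := h5
      exact hA (Module.injective_module_of_injective_object A A)
  · intro j hj
    obtain ⟨p, rfl⟩ : ∃ p, j = p + 1 := ⟨j - 1, by omega⟩
    rw [extZero_iff_s8]
    intro e
    rcases Nat.eq_zero_or_pos p with rfl | hp
    · -- Ext^1(T, C × I)
      let S' : ShortComplex (ModuleCat.{u} A) :=
        ShortComplex.mk (X₁ := ModuleCat.of A A) (X₂ := ModuleCat.of A (J × I))
          (X₃ := ModuleCat.of A (C × I))
          (ModuleCat.ofHom (LinearMap.inl A J I ∘ₗ f))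
          (ModuleCat.ofHom (LinearMap.prodMap g LinearMap.id)) (by
            exact ModuleCat.hom_ext (LinearMap.ext fun x =>
              Prod.ext (hfg.apply_apply_eq_zero x) rfl))
      have hS' : S'.ShortExact :=
        { exact := (ShortComplex.ShortExact.moduleCat_exact_iff_function_exact S').2 (by
            rintro ⟨x, y⟩
            constructor
            · intro h
              have h1 : g x = 0 := congrArg Prod.fst h
              have h2 : y = 0 := congrArg Prod.snd h
              obtain ⟨a, ha⟩ := (hfg x).1 h1
              exact ⟨a, Prod.ext ha h2.symm⟩
            · rintro ⟨a, ha⟩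
              have h1 : f a = x := congrArg Prod.fst ha
              have h2 : 0 = y := congrArg Prod.snd ha
              exact Prod.ext ((hfg x).2 ⟨a, h1⟩) h2.symm)
          mono_f := (ModuleCat.mono_iff_injective _).2 (fun a b hab =>
            hf (congrArg Prod.fst hab))
          epi_g := (ModuleCat.epi_iff_surjective _).2 (fun ⟨c, y⟩ => by
            obtain ⟨x, hx⟩ := hg c
            exact ⟨(x, y), Prod.ext hx rfl⟩) }
      have hinj : Injective (ModuleCat.of A (J × I)) := by
        have : Injective (J ⊞ ModuleCat.of A I) := inferInstance
        exact Injective.of_iso (ModuleCat.biprodIsoProd J (ModuleCat.of A I)) this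
      obtain ⟨e', he'⟩ := Abelian.Ext.covariant_sequence_exact₃ _ hS' e (n₁ := 2) rfl
        (Abelian.Ext.eq_zero_of_hasProjectiveDimensionLT _ 2 le_rfl)
      have h0 : e' = 0 := @Abelian.Ext.eq_zero_of_injective _ _ _ _ _ _ _ hinj e'
      rw [← he', h0, Abelian.Ext.zero_comp]
    · exact Abelian.Ext.eq_zero_of_hasProjectiveDimensionLT e 2 (by omega)
  · refine ⟨1, ![ModuleCat.of A A, C, ModuleCat.of A PUnit], ![J, C], ?_⟩
    refine ⟨Fin.cons f (Fin.cons LinearMap.id (fun i => i.elim0)),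
      Fin.cons g (Fin.cons 0 (fun i => i.elim0)), ⟨LinearEquiv.refl A A⟩, ?_, ?_, ?_, ?_, ?_⟩
    · exact inferInstanceAs (Subsingleton PUnit)
    · intro i
      fin_cases i
      · obtain ⟨m, Y, ⟨e⟩⟩ := hJI
        refine ⟨m, ModuleCat.of A (Y × (Fin m → C)), ⟨?_⟩⟩
        let e1 : (J × (Y × (Fin m → C))) ≃ₗ[A] ((J × Y) × (Fin m → C)) :=
          (LinearEquiv.prodAssoc A J Y (Fin m → C)).symm
        let e2 : ((J × Y) × (Fin m → C)) ≃ₗ[A] ((Fin m → I) × (Fin m → C)) :=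
          LinearEquiv.prodCongr e (LinearEquiv.refl A _)
        let e3 : ((Fin m → I) × (Fin m → C)) ≃ₗ[A] (Fin m → C × I) :=
          { toFun := fun x i => (x.2 i, x.1 i)
            invFun := fun x => (fun i => (x i).2, fun i => (x i).1)
            map_add' := fun _ _ => rfl
            map_smul' := fun _ _ => rfl
            left_inv := fun _ => rfl
            right_inv := fun _ => rfl }
        exact e1.trans (e2.trans e3)
      · exact ⟨1, ModuleCat.of A I, ⟨(LinearEquiv.funUnique (Fin 1) A (C × I)).symm⟩⟩
    · intro i
      fin_cases i
      · exact hf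
      · exact Function.injective_id
    · intro i
      fin_cases i
      · exact hg
      · exact fun x => ⟨0, rfl⟩
    · intro i
      fin_cases i
      · exact hfg
      · exact fun x => ⟨fun _ => ⟨x, rfl⟩, fun _ => rfl⟩

/-- Let `A` be a non-self-injective artin algebra and `I` an injective
module with `pd I ≤ 1`. Suppose `A` has a minimal injective coresolution
`0 → A → I⁰ → I¹ → ⋯` whose terms `I⁰, …, Iⁿ` lie in `add I` (encoded by short exact
sequences `0 → K_i → I^i → K_{i+1} → 0` in which each `K_i → I^i` is an injective hull and
`K 0 ≅ A`). Then `T := A¹ ⊕ I`, with `A¹ = K 1` the cokernel of `A → I⁰`, is a tilting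
module of projective dimension exactly `1`. -/
theorem stmt8 (R₀ : Type u) [CommRing R₀] [IsArtinianRing R₀]
    (A : Type u) [Ring A] [Algebra R₀ A] [Module.Finite R₀ A]
    (hA : ¬ Module.Injective A A)
    (I : Type u) [AddCommGroup I] [Module A I]
    (hIinj : Module.Injective A I) (hIpd : projDim A I ≤ (1 : ℕ∞))
    (n : ℕ) (K : Fin (n + 2) → ModuleCat.{u} A) (Is : Fin (n + 1) → ModuleCat.{u} A)
    (f : ∀ i : Fin (n + 1), ↥(K i.castSucc) →ₗ[A] ↥(Is i))
    (g : ∀ i : Fin (n + 1), ↥(Is i) →ₗ[A] ↥(K i.succ))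
    (hK0 : Nonempty (A ≃ₗ[A] K 0))
    (hhull : ∀ i, IsInjHull A (f i))
    (hepi : ∀ i, Function.Surjective (g i))
    (hexact : ∀ i, Function.Exact (f i) (g i))
    (hIs : ∀ i, InAdd A I (Is i)) :
    projDim A (↥(K 1) × I) = (1 : ℕ∞) ∧
      (∀ j : ℕ, 1 ≤ j → ExtZero A j (↥(K 1) × I) (↥(K 1) × I)) ∧
      ∃ m : ℕ, HasAddCoresolution A (↥(K 1) × I) A m := by
  obtain ⟨e⟩ := hK0
  have key : ∀ j : Fin (n + 2), j = (0 : Fin (n + 1)).succ →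
      ∃ g' : ↥(Is 0) →ₗ[A] ↥(K j), Function.Surjective g' ∧ Function.Exact (f 0) g' := by
    rintro _ rfl
    exact ⟨g 0, hepi 0, hexact 0⟩
  obtain ⟨g', hg', hfg'⟩ := key 1 (by simp)
  let e' : A ≃ₗ[A] ↥(K (Fin.castSucc 0)) := e
  refine main_aux A hA I hIinj hIpd (Is 0) (K 1) (f 0 ∘ₗ e'.toLinearMap) g' (hhull 0).1
    ((hhull 0).2.1.comp e'.injective) hg' ?_ (hIs 0)
  intro x
  rw [hfg' x]
  constructor
  · rintro ⟨y, rfl⟩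
    exact ⟨e'.symm y, congrArg (f 0) (e'.apply_symm_apply y)⟩
  · rintro ⟨y, rfl⟩
    exact ⟨e' y, rfl⟩
end

section
/- Let A be an artin algebra, Q an A-module with pd Q ≤ 1 and Ext_A^1(Q, Q) = 0, and let 0 → A → Q⁰ → A¹ → 0 be exact where A → Q⁰ is a minimal left add Q-approximation which is not surjective. Then Ext_A^1(A¹ ⊕ Q, A¹ ⊕ Q) = 0 and pd(A¹ ⊕ Q) ≤ 1. -/
open CategoryTheory TensorProduct

universe u

/-- `f : X → Z` is a minimal left `add Q`-approximation: `Z ∈ add Q`,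
`Hom(f, Q)` is surjective, and any `g : Z → Z` with `g ∘ f = f` is an automorphism. -/
def MinLeftApprox (A : Type u) [Ring A] (Q : Type u) [AddCommGroup Q] [Module A Q]
    {X Z : Type u} [AddCommGroup X] [Module A X] [AddCommGroup Z] [Module A Z]
    (f : X →ₗ[A] Z) : Prop :=
  InAdd A Q Z ∧ (∀ φ : X →ₗ[A] Q, ∃ ψ : Z →ₗ[A] Q, ψ ∘ₗ f = φ) ∧
    ∀ g : Z →ₗ[A] Z, g ∘ₗ f = f → Function.Bijective g


theorem bridge_aux {C : Type*} [Category C] [Abelian C] [Linear ℤ C] [EnoughProjectives C]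
    [HasExt.{u} C] (n : ℕ) (X Y : C) :
    Subsingleton (((Ext ℤ C (n+1)).obj (Opposite.op X)).obj Y) ↔
      Subsingleton (Abelian.Ext X Y (n+1)) := by
  let P := projectiveResolution X
  rw [(P.isoExt (R := ℤ) (n+1) Y).toLinearEquiv.toEquiv.subsingleton_congr,
    ← ModuleCat.isZero_iff_subsingleton]
  rw [← HomologicalComplex.exactAt_iff_isZero_homology,
    HomologicalComplex.exactAt_iff' _ n (n+1) (n+2) (by simp) (by simp),
    ShortComplex.moduleCat_exact_iff]
  constructor
  · intro h
    refine subsingleton_of_forall_eq 0 fun e => ?_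
    obtain ⟨f, hf, rfl⟩ := P.extMk_surjective e (n+2) rfl
    rw [P.extMk_eq_zero_iff f (n+2) rfl hf n rfl]
    exact h f hf
  · intro h f hf
    exact (P.extMk_eq_zero_iff (Y := Y) f (n+2) rfl hf n rfl).1 (Subsingleton.elim _ _)

theorem extZero_iff_aux (A : Type u) [Ring A] (n : ℕ) (X Y : Type u) [AddCommGroup X] [Module A X]
    [AddCommGroup Y] [Module A Y] : ExtZero A (n+1) X Y ↔
      ∀ e : Abelian.Ext.{u} (ModuleCat.of A X) (ModuleCat.of A Y) (n+1), e = 0 :=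
  (bridge_aux n (ModuleCat.of A X) (ModuleCat.of A Y)).trans
    ⟨fun _ _ => Subsingleton.elim _ _, fun h => subsingleton_of_forall_eq 0 h⟩

theorem projDim_le_one_iff_aux (A : Type u) [Ring A] (X : Type u) [AddCommGroup X] [Module A X] :
    projDim A X ≤ (1 : ℕ∞) ↔ ProjDimLE A X 1 := by
  constructor
  · intro h
    have hne : ((fun n : ℕ => (n : ℕ∞)) '' {n : ℕ | ProjDimLE A X n}).Nonempty := by
      by_contra hc
      rw [Set.not_nonempty_iff_eq_empty] at hc
      rw [projDim, hc, sInf_empty] at h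
      simp at h
    obtain ⟨n, hn, hn'⟩ := csInf_mem hne
    have h1 : (n : ℕ∞) ≤ 1 := hn'.trans_le h
    have h2 : n ≤ 1 := by exact_mod_cast h1
    exact fun k hk => hn k (by omega)
  · intro h
    exact sInf_le ⟨1, h, by simp⟩

section
open Abelian
variable {C : Type*} [Category C] [Abelian C] [HasExt.{u} C]

theorem ext_zero_of_factor_left {X Y : C} {I : Type} [Fintype I] (Z : I → C) (a : ∀ i, X ⟶ Z i)
    (b : ∀ i, Z i ⟶ X) (hab : ∑ i, a i ≫ b i = 𝟙 X) (k : ℕ)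
    (h : ∀ i, ∀ e : Ext (Z i) Y k, e = 0) (e : Ext X Y k) : e = 0 := by
  rw [← Ext.mk₀_id_comp e, ← hab, Ext.mk₀_sum, Ext.sum_comp]
  refine Finset.sum_eq_zero fun i _ => ?_
  rw [← Ext.mk₀_comp_mk₀, Ext.comp_assoc_of_second_deg_zero,
    h i ((Ext.mk₀ (b i)).comp e (zero_add k)), Ext.comp_zero]

theorem ext_zero_of_factor_right {X Y : C} {I : Type} [Fintype I] (Z : I → C) (a : ∀ i, X ⟶ Z i)
    (b : ∀ i, Z i ⟶ X) (hab : ∑ i, a i ≫ b i = 𝟙 X) (k : ℕ)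
    (h : ∀ i, ∀ e : Ext Y (Z i) k, e = 0) (e : Ext Y X k) : e = 0 := by
  rw [← Ext.comp_mk₀_id e, ← hab, Ext.mk₀_sum, Ext.comp_sum]
  refine Finset.sum_eq_zero fun i _ => ?_
  rw [← Ext.mk₀_comp_mk₀, ← Ext.comp_assoc_of_third_deg_zero,
    h i (e.comp (Ext.mk₀ (a i)) (add_zero k)), Ext.zero_comp]

end

theorem inAdd_factor_aux (A : Type u) [Ring A] (Q : Type u) [AddCommGroup Q] [Module A Q]
    (X : Type u) [AddCommGroup X] [Module A X] (h : InAdd A Q X) :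
    ∃ (n : ℕ) (a : Fin n → (ModuleCat.of A X ⟶ ModuleCat.of A Q))
      (b : Fin n → (ModuleCat.of A Q ⟶ ModuleCat.of A X)), ∑ i, a i ≫ b i = 𝟙 _ := by
  obtain ⟨n, Y, ⟨e⟩⟩ := h
  refine ⟨n, fun i => ModuleCat.ofHom (LinearMap.proj i ∘ₗ e.toLinearMap ∘ₗ LinearMap.inl A X Y),
    fun i => ModuleCat.ofHom (LinearMap.fst A X Y ∘ₗ e.symm.toLinearMap ∘ₗ
      LinearMap.single A (fun _ => Q) i), ?_⟩
  ext x
  have : ∑ i, (e.symm (Pi.single i (e (x, 0) i))) = (x, 0) := by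
    rw [← map_sum, Finset.univ_sum_single, e.symm_apply_apply]
  simpa [ModuleCat.hom_sum, LinearMap.sum_apply, Prod.fst_sum] using congrArg Prod.fst this

theorem prod_factor_aux (A : Type u) [Ring A] (X Y : Type u) [AddCommGroup X] [Module A X]
    [AddCommGroup Y] [Module A Y] :
    ∃ (Z : Bool → ModuleCat.{u} A) (a : ∀ i, ModuleCat.of A (X × Y) ⟶ Z i)
      (b : ∀ i, Z i ⟶ ModuleCat.of A (X × Y)), Z true = ModuleCat.of A X ∧
        Z false = ModuleCat.of A Y ∧ ∑ i, a i ≫ b i = 𝟙 _ := by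
  refine ⟨fun i => bif i then ModuleCat.of A X else ModuleCat.of A Y,
    fun i => match i with
      | true => ModuleCat.ofHom (LinearMap.fst A X Y)
      | false => ModuleCat.ofHom (LinearMap.snd A X Y),
    fun i => match i with
      | true => ModuleCat.ofHom (LinearMap.inl A X Y)
      | false => ModuleCat.ofHom (LinearMap.inr A X Y), rfl, rfl, ?_⟩
  rw [Fintype.sum_bool]
  change ModuleCat.ofHom (LinearMap.fst A X Y) ≫ ModuleCat.ofHom (LinearMap.inl A X Y) +
    ModuleCat.ofHom (LinearMap.snd A X Y) ≫ ModuleCat.ofHom (LinearMap.inr A X Y) = _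
  ext x <;> simp

theorem extZero_prod_left_aux (A : Type u) [Ring A] (X Y W : Type u) [AddCommGroup X] [Module A X]
    [AddCommGroup Y] [Module A Y] [AddCommGroup W] [Module A W] (n : ℕ)
    (h1 : ExtZero A (n+1) X W) (h2 : ExtZero A (n+1) Y W) : ExtZero A (n+1) (X × Y) W := by
  rw [extZero_iff_aux] at *
  obtain ⟨Z, a, b, hX, hY, hab⟩ := prod_factor_aux A X Y
  refine ext_zero_of_factor_left Z a b hab _ ?_
  rintro (_ | _)
  · rw [hY]; exact h2
  · rw [hX]; exact h1

theorem extZero_prod_right_aux (A : Type u) [Ring A] (X Y W : Type u) [AddCommGroup X] [Module A X]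
    [AddCommGroup Y] [Module A Y] [AddCommGroup W] [Module A W] (n : ℕ)
    (h1 : ExtZero A (n+1) W X) (h2 : ExtZero A (n+1) W Y) : ExtZero A (n+1) W (X × Y) := by
  rw [extZero_iff_aux] at *
  obtain ⟨Z, a, b, hX, hY, hab⟩ := prod_factor_aux A X Y
  refine ext_zero_of_factor_right Z a b hab _ ?_
  rintro (_ | _)
  · rw [hY]; exact h2
  · rw [hX]; exact h1

theorem extZero_add_left_aux (A : Type u) [Ring A] (Q X W : Type u) [AddCommGroup Q] [Module A Q]
    [AddCommGroup X] [Module A X] [AddCommGroup W] [Module A W] (n : ℕ) (hX : InAdd A Q X)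
    (h1 : ExtZero A (n+1) Q W) : ExtZero A (n+1) X W := by
  rw [extZero_iff_aux] at *
  obtain ⟨m, a, b, hab⟩ := inAdd_factor_aux A Q X hX
  exact ext_zero_of_factor_left _ a b hab _ fun _ => h1

theorem extZero_add_right_aux (A : Type u) [Ring A] (Q X W : Type u) [AddCommGroup Q] [Module A Q]
    [AddCommGroup X] [Module A X] [AddCommGroup W] [Module A W] (n : ℕ) (hX : InAdd A Q X)
    (h1 : ExtZero A (n+1) W Q) : ExtZero A (n+1) W X := by
  rw [extZero_iff_aux] at *
  obtain ⟨m, a, b, hab⟩ := inAdd_factor_aux A Q X hX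
  exact ext_zero_of_factor_right _ a b hab _ fun _ => h1

/-- Let `A` be an artin algebra, `Q` a module with `pd Q ≤ 1` and
`Ext¹(Q,Q) = 0`, and `0 → A → Q⁰ → A¹ → 0` exact, where `ι : A → Q⁰` is a non-surjective
minimal left `add Q`-approximation. Then `T := A¹ ⊕ Q` satisfies `Ext¹(T, T) = 0` and
`pd T ≤ 1`. -/
theorem stmt9 (R₀ : Type u) [CommRing R₀] [IsArtinianRing R₀]
    (A : Type u) [Ring A] [Algebra R₀ A] [Module.Finite R₀ A]
    (Q : Type u) [AddCommGroup Q] [Module A Q]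
    (hQpd : projDim A Q ≤ (1 : ℕ∞)) (hQext : ExtZero A 1 Q Q)
    (Q0 A1 : Type u) [AddCommGroup Q0] [Module A Q0] [AddCommGroup A1] [Module A A1]
    (ι : A →ₗ[A] Q0) (π : Q0 →ₗ[A] A1)
    (hmono : Function.Injective ι) (hepi : Function.Surjective π)
    (hexact : Function.Exact ι π)
    (happrox : MinLeftApprox A Q ι) (hnotsurj : ¬ Function.Surjective ι) :
    ExtZero A 1 (A1 × Q) (A1 × Q) ∧ projDim A (A1 × Q) ≤ (1 : ℕ∞) := by
  rw [projDim_le_one_iff_aux] at hQpd ⊢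
  obtain ⟨hadd, hlift, -⟩ := happrox
  let S : ShortComplex (ModuleCat.{u} A) :=
    ShortComplex.mk (ModuleCat.ofHom ι) (ModuleCat.ofHom π) (by
      ext x
      simpa using hexact.apply_apply_eq_zero _)
  have hS : S.ShortExact :=
    { exact := by
        rw [ShortComplex.ShortExact.moduleCat_exact_iff_function_exact]
        exact hexact
      mono_f := (ModuleCat.mono_iff_injective _).2 hmono
      epi_g := (ModuleCat.epi_iff_surjective _).2 hepi }
  have hproj : Projective S.X₁ := inferInstanceAs (Projective (ModuleCat.of A A))
  -- the vanishing of higher extensions out of the cokernel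
  have hA1pd : ProjDimLE A A1 1 := by
    intro k hk Y
    obtain ⟨k, rfl⟩ : ∃ m, k = m + 1 + 1 := ⟨k - 2, by omega⟩
    have h0 := (extZero_iff_aux A (k+1) Q0 Y).1
      (extZero_add_left_aux A Q Q0 Y (k+1) hadd (hQpd _ hk Y))
    rw [extZero_iff_aux]
    intro e
    obtain ⟨x, rfl⟩ := Abelian.Ext.contravariant_sequence_exact₃ hS (ModuleCat.of A Y) e (h0 _)
      (n₀ := k + 1) (by omega)
    rw [Abelian.Ext.eq_zero_of_hasProjectiveDimensionLT x 1 (by omega), Abelian.Ext.comp_zero]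
  have hA1Q : ExtZero A 1 A1 Q := by
    have h0 := (extZero_iff_aux A 0 Q0 Q).1 (extZero_add_left_aux A Q Q0 Q 0 hadd hQext)
    rw [extZero_iff_aux A 0]
    intro e
    obtain ⟨x, rfl⟩ := Abelian.Ext.contravariant_sequence_exact₃ hS (ModuleCat.of A Q) e (h0 _)
      (n₀ := 0) (by omega)
    obtain ⟨f, rfl⟩ := Abelian.Ext.addEquiv₀.symm.surjective x
    obtain ⟨ψ, hψ⟩ := hlift f.hom
    have hf : f = S.f ≫ ModuleCat.ofHom ψ := by
      ext1
      exact hψ.symm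
    have : Abelian.Ext.addEquiv₀.symm f =
      (Abelian.Ext.mk₀ S.f).comp (Abelian.Ext.mk₀ (ModuleCat.ofHom ψ)) (zero_add 0) := by
      rw [Abelian.Ext.mk₀_comp_mk₀, ← hf]; rfl
    rw [this, ShortComplex.ShortExact.extClass_comp_assoc]
  have key : ∀ (X : Type u) [AddCommGroup X] [Module A X], ExtZero A 1 X Q → ProjDimLE A X 1 →
      ExtZero A 1 X A1 := by
    intro X _ _ h1 h2
    have h0 := (extZero_iff_aux A 0 X Q0).1 (extZero_add_right_aux A Q Q0 X 0 hadd h1)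
    have h3 := (extZero_iff_aux A 1 X A).1 (h2 2 (by omega) (ModuleCat.of A A))
    rw [extZero_iff_aux A 0]
    intro e
    obtain ⟨x, rfl⟩ := Abelian.Ext.covariant_sequence_exact₃ (ModuleCat.of A X) hS e
      (n₁ := 2) rfl (h3 _)
    rw [h0 x, Abelian.Ext.zero_comp]
  refine ⟨?_, ?_⟩
  · exact extZero_prod_left_aux A _ _ _ 0
      (extZero_prod_right_aux A _ _ _ 0 (key A1 hA1Q hA1pd) hA1Q)
      (extZero_prod_right_aux A _ _ _ 0 (key Q hQext hQpd) hQext)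
  · intro k hk Y
    obtain ⟨k, rfl⟩ : ∃ m, k = m + 1 := ⟨k - 1, by omega⟩
    exact extZero_prod_left_aux A _ _ _ k (hA1pd _ hk Y) (hQpd _ hk Y)
end

section
/- Let A be an artin algebra with injective dimension of A (as a right module) equal to m+1, and suppose the global dimension of A is finite. Then the global dimension of A equals m+1. -/
open CategoryTheory TensorProduct

universe u

/-- The global dimension of `A`: the supremum of the projective dimensions of the finitely
generated `A`-modules, as an element of `ℕ∞`. -/
noncomputable def gldim (A : Type u) [Ring A] : ℕ∞ :=
  sSup {d : ℕ∞ | ∃ X : ModuleCat.{u} A, Module.Finite A X ∧ projDim A X = d}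

section Helpers

theorem aux_bridge (A : Type u) [Ring A] (k : ℕ) (X Y : ModuleCat.{u} A) :
    ExtZero A (k + 1) X Y ↔ Subsingleton (Abelian.Ext X Y (k + 1)) := by
  let P := ProjectiveResolution.of X
  have h1 : ExtZero A (k + 1) X Y ↔
      ((P.complex.linearYonedaObj ℤ Y).ExactAt (k + 1)) := by
    rw [HomologicalComplex.exactAt_iff_isZero_homology,
      ← (P.isoExt (R := ℤ) (k + 1) Y).isZero_iff, ModuleCat.isZero_iff_subsingleton]
    rfl
  rw [h1, HomologicalComplex.exactAt_iff' _ k (k + 1) (k + 2) (by simp) (by simp),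
    ShortComplex.moduleCat_exact_iff]
  constructor
  · intro h
    refine subsingleton_of_forall_eq 0 fun α => ?_
    obtain ⟨f, hf, rfl⟩ := P.extMk_surjective α (k + 2) rfl
    rw [P.extMk_eq_zero_iff f (k + 2) rfl hf k rfl]
    exact h f hf
  · intro h f hf
    have := (P.extMk_eq_zero_iff (n := k + 1) f (k + 2) rfl hf k rfl).1 (Subsingleton.elim _ _)
    exact this

theorem aux_pd (A : Type u) [Ring A] (X : ModuleCat.{u} A) (n : ℕ) :
    ProjDimLE A X n ↔ HasProjectiveDimensionLT X (n + 1) := by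
  constructor
  · intro h
    refine HasProjectiveDimensionLT.mk fun i hi Y e => ?_
    obtain ⟨j, rfl⟩ : ∃ j, i = j + 1 := ⟨i - 1, by omega⟩
    have := (aux_bridge A j X Y).1 (h _ (by omega) Y)
    exact Subsingleton.elim _ _
  · intro h i hi Y
    obtain ⟨j, rfl⟩ : ∃ j, i = j + 1 := ⟨i - 1, by omega⟩
    exact (aux_bridge A j X Y).2 (HasProjectiveDimensionLT.subsingleton X (n + 1) _ (by omega) Y)

theorem aux_id (A : Type u) [Ring A] (X : ModuleCat.{u} A) (n : ℕ) :
    InjDimLE A X n ↔ HasInjectiveDimensionLT X (n + 1) := by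
  constructor
  · intro h
    refine HasInjectiveDimensionLT.mk fun i hi Y e => ?_
    obtain ⟨j, rfl⟩ : ∃ j, i = j + 1 := ⟨i - 1, by omega⟩
    have := (aux_bridge A j Y X).1 (h _ (by omega) Y)
    exact Subsingleton.elim _ _
  · intro h i hi Y
    obtain ⟨j, rfl⟩ : ∃ j, i = j + 1 := ⟨i - 1, by omega⟩
    exact (aux_bridge A j Y X).2 (HasInjectiveDimensionLT.subsingleton X (n + 1) _ (by omega) Y)

theorem aux_ext_proj (A : Type u) [Ring A] (X P : ModuleCat.{u} A) [Module.Finite A P]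
    [Module.Projective A P] (n : ℕ) (h : Subsingleton (Abelian.Ext X (ModuleCat.of A A) n)) :
    Subsingleton (Abelian.Ext X P n) := by
  obtain ⟨k, f, hf⟩ := Module.Finite.exists_fin' A P
  obtain ⟨s, hs⟩ := Module.projective_lifting_property f LinearMap.id hf
  have hid : 𝟙 P = ∑ i : Fin k, (ModuleCat.ofHom ((LinearMap.proj i).comp s) :
      P ⟶ ModuleCat.of A A) ≫
      ModuleCat.ofHom (f.comp (LinearMap.single A (fun _ : Fin k => A) i)) := by
    ext x
    have h1 : f (s x) = x := LinearMap.congr_fun hs x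
    have h2 : s x = ∑ i, Pi.single i (s x i) := (Finset.univ_sum_single (s x)).symm
    conv_lhs => rw [ModuleCat.hom_id, LinearMap.id_apply, ← h1, h2, map_sum]
    simp [ModuleCat.hom_sum]
  refine subsingleton_of_forall_eq 0 fun e => ?_
  rw [← e.comp_mk₀_id, hid, Abelian.Ext.mk₀_sum, Abelian.Ext.comp_sum]
  refine Finset.sum_eq_zero fun i _ => ?_
  rw [← Abelian.Ext.mk₀_comp_mk₀, ← Abelian.Ext.comp_assoc_of_second_deg_zero,
    Subsingleton.elim (e.comp _ _) 0, Abelian.Ext.zero_comp]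

theorem aux_step (A : Type u) [Ring A] [IsNoetherianRing A] (n : ℕ) :
    ∀ (X : ModuleCat.{u} A) [Module.Finite A X],
    HasProjectiveDimensionLT X (n + 2) →
    Subsingleton (Abelian.Ext X (ModuleCat.of A A) (n + 1)) →
    HasProjectiveDimensionLT X (n + 1) := by
  induction n with
  | zero =>
    intro X _ hX hE
    obtain ⟨k, f, hf⟩ := Module.Finite.exists_fin' A X
    let S := f.shortComplexKer
    have hS : S.ShortExact := LinearMap.shortExact_shortComplexKer hf
    have hP : Projective S.X₂ := ModuleCat.projective_of_categoryTheory_projective _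
    have h1 : HasProjectiveDimensionLT S.X₁ 1 := (hS.hasProjectiveDimensionLT_X₃_iff 0 hP).1 hX
    have h2 : Projective S.X₁ := projective_iff_hasProjectiveDimensionLT_one.2 h1
    have h3 : Module.Projective A S.X₁ := (IsProjective.iff_projective _).2 h2
    have h5 : Module.Finite A S.X₁ := inferInstanceAs (Module.Finite A (LinearMap.ker f))
    have h4 := aux_ext_proj A X S.X₁ 1 hE
    obtain ⟨f', hf'⟩ := Abelian.Ext.covariant_sequence_exact₃ X hS (Abelian.Ext.mk₀ (𝟙 X))
      (zero_add 1) (Subsingleton.elim _ _)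
    obtain ⟨g, rfl⟩ := (Abelian.Ext.mk₀_bijective X S.X₂).2 f'
    rw [Abelian.Ext.mk₀_comp_mk₀, (Abelian.Ext.mk₀_bijective _ _).1.eq_iff] at hf'
    exact projective_iff_hasProjectiveDimensionLT_one.1 (Retract.mk g S.g hf').projective
  | succ n ih =>
    intro X _ hX hE
    obtain ⟨k, f, hf⟩ := Module.Finite.exists_fin' A X
    let S := f.shortComplexKer
    have hS : S.ShortExact := LinearMap.shortExact_shortComplexKer hf
    have hP : Projective S.X₂ := ModuleCat.projective_of_categoryTheory_projective _
    have h1 := (hS.hasProjectiveDimensionLT_X₃_iff (n + 1) hP).1 hX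
    have h5 : Module.Finite A S.X₁ := inferInstanceAs (Module.Finite A (LinearMap.ker f))
    refine (hS.hasProjectiveDimensionLT_X₃_iff n hP).2 (ih S.X₁ h1 ?_)
    refine subsingleton_of_forall_eq 0 fun e => ?_
    obtain ⟨x, rfl⟩ := Abelian.Ext.contravariant_sequence_exact₁ hS _ e (add_comm _ _)
      (Subsingleton.elim _ _)
    rw [Abelian.Ext.eq_zero_of_projective x, Abelian.Ext.comp_zero]

theorem aux_baer (A : Type u) [Ring A] (n : ℕ) :
    ∀ (Y : ModuleCat.{u} A),
    (∀ I : Submodule A A, Subsingleton (Abelian.Ext (ModuleCat.of A (A ⧸ I)) Y (n + 1))) →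
    HasInjectiveDimensionLT Y (n + 1) := by
  induction n with
  | zero =>
    intro Y h
    rw [zero_add, ← injective_iff_hasInjectiveDimensionLT_one,
      ← Module.injective_iff_injective_object A Y, ← Module.Baer.iff_injective]
    intro I g
    let S : ShortComplex (ModuleCat.{u} A) :=
      { X₁ := ModuleCat.of A I
        X₂ := ModuleCat.of A A
        X₃ := ModuleCat.of A (A ⧸ I)
        f := ModuleCat.ofHom (Submodule.subtype I)
        g := ModuleCat.ofHom (Submodule.mkQ I)
        zero := by ext; simp }
    have hS : S.ShortExact := ModuleCat.shortComplex_shortExact S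
      (LinearMap.exact_subtype_mkQ I) (Submodule.subtype_injective I) (Submodule.mkQ_surjective I)
    have := h I
    obtain ⟨x, hx⟩ := Abelian.Ext.contravariant_sequence_exact₁ hS Y
      (Abelian.Ext.mk₀ (ModuleCat.ofHom g : S.X₁ ⟶ Y)) (add_zero 1) (Subsingleton.elim _ _)
    obtain ⟨y, rfl⟩ := (Abelian.Ext.mk₀_bijective S.X₂ Y).2 x
    rw [Abelian.Ext.mk₀_comp_mk₀, (Abelian.Ext.mk₀_bijective _ _).1.eq_iff] at hx
    refine ⟨y.hom, fun a ha => ?_⟩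
    exact LinearMap.congr_fun (congrArg ModuleCat.Hom.hom hx) ⟨a, ha⟩
  | succ n ih =>
    intro Y h
    obtain ⟨E, _, f, _⟩ := EnoughInjectives.presentation Y
    have injf : Function.Injective f.hom := (ModuleCat.mono_iff_injective f).mp ‹_›
    let S : ShortComplex (ModuleCat.{u} A) :=
      ModuleCat.shortComplexOfCompEqZero _ _ f.hom.exact_map_mkQ_range.linearMap_comp_eq_zero
    have hS := ModuleCat.shortComplex_shortExact S
      f.hom.exact_map_mkQ_range injf (Submodule.mkQ_surjective _)
    refine (hS.hasInjectiveDimensionLT_X₃_iff n inferInstance).1 (ih S.X₃ fun I => ?_)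
    have := h I
    refine subsingleton_of_forall_eq 0 fun e => ?_
    obtain ⟨x, rfl⟩ := Abelian.Ext.covariant_sequence_exact₃ _ hS e rfl
      (Subsingleton.elim (α := Abelian.Ext (ModuleCat.of A (A ⧸ I)) Y (n + 1 + 1)) _ _)
    have hE : Injective S.X₂ := inferInstanceAs (Injective E)
    rw [Abelian.Ext.eq_zero_of_injective x, Abelian.Ext.zero_comp]

theorem aux_pd_le {A : Type u} [Ring A] (X : ModuleCat.{u} A) (n : ℕ) :
    projDim A X ≤ n ↔ HasProjectiveDimensionLT X (n + 1) := by
  rw [← aux_pd]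
  constructor
  · intro h k hk Y
    have h2 : projDim A X < k := lt_of_le_of_lt h (by exact_mod_cast hk)
    obtain ⟨_, ⟨j, hj, rfl⟩, hjk⟩ := sInf_lt_iff.1 h2
    exact hj k (Nat.cast_lt.1 hjk) Y
  · intro h
    exact sInf_le ⟨n, h, rfl⟩

theorem aux_id_le {A : Type u} [Ring A] (X : ModuleCat.{u} A) (n : ℕ) :
    injDim A X ≤ n ↔ HasInjectiveDimensionLT X (n + 1) := by
  rw [← aux_id]
  constructor
  · intro h k hk Y
    have h2 : injDim A X < k := lt_of_le_of_lt h (by exact_mod_cast hk)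
    obtain ⟨_, ⟨j, hj, rfl⟩, hjk⟩ := sInf_lt_iff.1 h2
    exact hj k (Nat.cast_lt.1 hjk) Y
  · intro h
    exact sInf_le ⟨n, h, rfl⟩

theorem aux_gl_le {A : Type u} [Ring A] (n : ℕ) :
    gldim A ≤ n ↔ ∀ X : ModuleCat.{u} A, Module.Finite A X →
      HasProjectiveDimensionLT X (n + 1) := by
  rw [gldim, sSup_le_iff]
  constructor
  · intro h X hX
    exact (aux_pd_le X n).1 (h _ ⟨X, hX, rfl⟩)
  · rintro h _ ⟨X, hX, rfl⟩
    exact (aux_pd_le X n).2 (h X hX)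

end Helpers

/-- Let `A` be an artin algebra with `id A = m + 1` (injective dimension of
the regular module) and finite global dimension. Then `gldim A = m + 1`. -/
theorem stmt10 (R₀ : Type u) [CommRing R₀] [IsArtinianRing R₀]
    (A : Type u) [Ring A] [Algebra R₀ A] [Module.Finite R₀ A]
    (m : ℕ) (hid : injDim A A = ((m : ℕ∞) + 1))
    (hgl : gldim A ≠ ⊤) :
    gldim A = ((m : ℕ∞) + 1) := by
  have : IsNoetherianRing A := isNoetherian_of_tower R₀ inferInstance
  obtain ⟨n, hn⟩ := ENat.ne_top_iff_exists.1 hgl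
  have hn' : gldim A ≤ (n : ℕ∞) := hn.ge
  apply le_antisymm
  · have hI : HasInjectiveDimensionLT (ModuleCat.of A A) (m + 1 + 1) :=
      (aux_id_le (ModuleCat.of A A) (m + 1)).1 (by push_cast; exact hid.le)
    have key : ∀ j : ℕ, gldim A ≤ ((m + 1 + j : ℕ) : ℕ∞) → gldim A ≤ ((m + 1 : ℕ) : ℕ∞) := by
      intro j
      induction j with
      | zero => exact id
      | succ j ih =>
        intro h
        apply ih
        rw [aux_gl_le] at h ⊢
        intro X hX
        exact aux_step A (m + 1 + j) X (h X hX)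
          (HasInjectiveDimensionLT.subsingleton _ (m + 1 + 1) _ (by omega) X)
    have := key n (hn'.trans (by exact_mod_cast (by omega : n ≤ m + 1 + n)))
    exact_mod_cast this
  · rw [← hid, ← hn]
    apply (aux_id_le (ModuleCat.of A A) n).2
    apply aux_baer
    intro I
    have := (aux_gl_le n).1 hn' (ModuleCat.of A (A ⧸ I))
      (inferInstanceAs (Module.Finite A (A ⧸ I)))
    exact HasProjectiveDimensionLT.subsingleton _ (n + 1) _ le_rfl _
end

section
/- Let A be an artin algebra with id A = m+1 and a minimal injective coresolution 0 → A → I⁰ → ⋯ → I^{m+1} → 0. Suppose I⁰, I¹, …, I^m all have projective dimension at most 1 (i.e., gdom_I A ≥ m+1 where I is the sum of all indecomposable injectives of projective dimension at most one). Then every injective A-module is a direct summand of a finite direct sum of copies of I⁰ ⊕ I¹ ⊕ ⋯ ⊕ I^{m+1}. -/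
open CategoryTheory TensorProduct

universe u

/-- An `A`-module is indecomposable: nonzero, and any direct sum decomposition has a
trivial factor. -/
def Indecomp (A : Type u) [Ring A] (X : Type u) [AddCommGroup X] [Module A X] : Prop :=
  ¬ Subsingleton X ∧
    ∀ Y Z : ModuleCat.{u} A, Nonempty (X ≃ₗ[A] (Y × Z)) → Subsingleton Y ∨ Subsingleton Z

namespace Tilt

theorem bridge (A : Type u) [Ring A] (X : ModuleCat.{u} A) (n : ℕ)
    (h : ∀ Y : ModuleCat.{u} A, ExtZero A (n+1) X Y) : HasProjectiveDimensionLT X (n+1) := by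
  apply hasProjectiveDimensionLT_of_enoughInjectives
  intro Y
  have P : ProjectiveResolution X := ProjectiveResolution.of X
  have hs : Subsingleton (((Ext ℤ (ModuleCat.{u} A) (n+1)).obj (Opposite.op X)).obj Y) := h Y
  have hz : Limits.IsZero ((P.complex.linearYonedaObj ℤ Y).homology (n+1)) := by
    apply Limits.IsZero.of_iso _ (P.isoExt (R := ℤ) (n+1) Y).symm
    exact ModuleCat.isZero_of_subsingleton _
  rw [← HomologicalComplex.exactAt_iff_isZero_homology,
    HomologicalComplex.exactAt_iff' _ n (n+1) (n+2) (by simp) (by simp)] at hz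
  rw [ShortComplex.moduleCat_exact_iff] at hz
  suffices ∀ e : Abelian.Ext X Y (n+1), e = 0 from ⟨fun a b => by rw [this a, this b]⟩
  intro e
  obtain ⟨f, hf, rfl⟩ := P.extMk_surjective e (n+2) rfl
  rw [P.extMk_eq_zero_iff f (n+2) rfl hf n rfl]
  obtain ⟨g, hg⟩ := hz f hf
  exact ⟨g, hg⟩

theorem pd_of_projDim (A : Type u) [Ring A] (X : ModuleCat.{u} A)
    (h : projDim A X ≤ (1 : ℕ∞)) : HasProjectiveDimensionLT X 2 := by
  apply bridge
  unfold projDim at h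
  have h2 : sInf ((fun n : ℕ => (n : ℕ∞)) '' {n : ℕ | ProjDimLE A X n}) < 2 :=
    lt_of_le_of_lt h (by norm_num)
  rw [sInf_lt_iff] at h2
  obtain ⟨_, ⟨n, hn, rfl⟩, hlt⟩ := h2
  have hlt2 : (n : ℕ∞) < 2 := hlt
  have : n < 2 := by exact_mod_cast hlt2
  intro Y
  exact hn 2 this Y

/-- short exactness of a pair of linear maps -/
def SES {A : Type u} [Ring A] {X Y Z : ModuleCat.{u} A} (f : X →ₗ[A] Y) (g : Y →ₗ[A] Z) : Prop :=
  Function.Injective f ∧ Function.Exact f g ∧ Function.Surjective g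

theorem SES.shortExact {A : Type u} [Ring A] {X Y Z : ModuleCat.{u} A} {f : X →ₗ[A] Y}
    {g : Y →ₗ[A] Z} (h : SES f g) :
    ∃ w, (ShortComplex.mk (ModuleCat.ofHom f) (ModuleCat.ofHom g) w).ShortExact := by
  refine ⟨?_, ?_⟩
  · ext x; exact h.2.1.apply_apply_eq_zero x
  · have h1 : Mono (ModuleCat.ofHom f) := (ModuleCat.mono_iff_injective _).2 h.1
    have h2 : Epi (ModuleCat.ofHom g) := (ModuleCat.epi_iff_surjective _).2 h.2.2
    refine ShortComplex.ShortExact.mk' ?_ h1 h2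
    rw [ShortComplex.moduleCat_exact_iff]
    intro x hx
    exact (h.2.1 x).1 hx

section
variable {A : Type u} [Ring A] {X Y Z : ModuleCat.{u} A} {f : X →ₗ[A] Y} {g : Y →ₗ[A] Z}

theorem SES.pd3 (h : SES f g) {n : ℕ} (h1 : HasProjectiveDimensionLT X n)
    (h2 : HasProjectiveDimensionLT Y (n+1)) : HasProjectiveDimensionLT Z (n+1) := by
  obtain ⟨w, hw⟩ := h.shortExact
  exact hw.hasProjectiveDimensionLT_X₃ n h1 h2

theorem SES.pd2 (h : SES f g) {n : ℕ} (h1 : HasProjectiveDimensionLT X n)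
    (h2 : HasProjectiveDimensionLT Z n) : HasProjectiveDimensionLT Y n := by
  obtain ⟨w, hw⟩ := h.shortExact
  exact hw.hasProjectiveDimensionLT_X₂ n h1 h2

theorem SES.pd1 (h : SES f g) {n : ℕ} (h1 : HasProjectiveDimensionLT Y n)
    (h2 : HasProjectiveDimensionLT Z (n+1)) : HasProjectiveDimensionLT X n := by
  obtain ⟨w, hw⟩ := h.shortExact
  exact hw.hasProjectiveDimensionLT_X₁ n h1 h2

theorem SES.id3 (h : SES f g) {n : ℕ} (h1 : HasInjectiveDimensionLT X (n+1))
    (h2 : HasInjectiveDimensionLT Y n) : HasInjectiveDimensionLT Z n := by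
  obtain ⟨w, hw⟩ := h.shortExact
  exact hw.hasInjectiveDimensionLT_X₃ n h2 h1

theorem SES.id1 (h : SES f g) {n : ℕ} (h1 : HasInjectiveDimensionLT Z n)
    (h2 : HasInjectiveDimensionLT Y (n+1)) : HasInjectiveDimensionLT X (n+1) := by
  obtain ⟨w, hw⟩ := h.shortExact
  exact hw.hasInjectiveDimensionLT_X₁ n h1 h2

/-- all Ext from S to X vanish -/
def Orth (S X : ModuleCat.{u} A) : Prop := ∀ i, ∀ e : Abelian.Ext.{u} S X i, e = 0

theorem SES.orth1 (h : SES f g) {S : ModuleCat.{u} A} (h1 : Orth S Y) (h2 : Orth S Z) :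
    Orth S X := by
  obtain ⟨w, hw⟩ := h.shortExact
  have := hw.mono_f
  intro i e
  cases i with
  | zero =>
    apply Abelian.Ext.postcomp_mk₀_injective_of_mono S (ModuleCat.ofHom f)
    rw [h1 0 (((Abelian.Ext.mk₀ (ModuleCat.ofHom f)).postcomp S (add_zero 0)) e), map_zero]
  | succ i =>
    obtain ⟨x, rfl⟩ := Abelian.Ext.covariant_sequence_exact₁ S hw e (h1 _ _) rfl
    rw [h2 _ x, Abelian.Ext.zero_comp]

theorem SES.orth3 (h : SES f g) {S : ModuleCat.{u} A} (h1 : Orth S X) (h2 : Orth S Y) :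
    Orth S Z := by
  obtain ⟨w, hw⟩ := h.shortExact
  intro i e
  obtain ⟨x, rfl⟩ := Abelian.Ext.covariant_sequence_exact₃ S hw e rfl (h1 _ _)
  rw [h2 _ x, Abelian.Ext.zero_comp]

theorem orth_of_inj {S X : ModuleCat.{u} A} [Module.Injective A X] (h : ∀ f : S →ₗ[A] X, f = 0) :
    Orth S X := by
  have : Injective X := Module.injective_object_of_injective_module A X
  intro i e
  cases i with
  | zero =>
    obtain ⟨g, rfl⟩ := Abelian.Ext.addEquiv₀.symm.surjective e
    have : g = 0 := by ext x; simp [h g.hom]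
    simp [this]
  | succ i => exact Abelian.Ext.eq_zero_of_injective _

theorem Orth.hom {S X : ModuleCat.{u} A} (h : Orth S X) (f : S →ₗ[A] X) : f = 0 := by
  have := h 0 (Abelian.Ext.mk₀ (ModuleCat.ofHom f))
  rw [Abelian.Ext.mk₀_eq_zero_iff] at this
  exact congrArg ModuleCat.Hom.hom this

theorem pd_of_retract (s : X →ₗ[A] Y) (r : Y →ₗ[A] X) (h : ∀ x, r (s x) = x) {n : ℕ}
    (hY : HasProjectiveDimensionLT Y n) : HasProjectiveDimensionLT X n :=
  (Retract.mk (ModuleCat.ofHom s) (ModuleCat.ofHom r)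
    (by ext x; exact h x)).hasProjectiveDimensionLT n

theorem id_of_retract (s : X →ₗ[A] Y) (r : Y →ₗ[A] X) (h : ∀ x, r (s x) = x) {n : ℕ}
    (hY : HasInjectiveDimensionLT Y n) : HasInjectiveDimensionLT X n :=
  (Retract.mk (ModuleCat.ofHom s) (ModuleCat.ofHom r)
    (by ext x; exact h x)).hasInjectiveDimensionLT n

theorem orth_of_retract {S : ModuleCat.{u} A} (s : X →ₗ[A] Y) (r : Y →ₗ[A] X)
    (h : ∀ x, r (s x) = x) (hY : Orth S Y) : Orth S X := by
  intro i e
  have : ModuleCat.ofHom s ≫ ModuleCat.ofHom r = 𝟙 X := by ext x; exact h x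
  have h2 := Abelian.Ext.comp_assoc_of_third_deg_zero e (Abelian.Ext.mk₀ (ModuleCat.ofHom s))
    (Abelian.Ext.mk₀ (ModuleCat.ofHom r)) (add_zero i)
  rw [hY _ (e.comp _ _), Abelian.Ext.mk₀_comp_mk₀, this, Abelian.Ext.comp_mk₀_id,
    Abelian.Ext.zero_comp] at h2
  exact h2.symm

theorem inj_of_retract {X Y : Type u} [AddCommGroup X] [Module A X] [AddCommGroup Y] [Module A Y]
    (s : X →ₗ[A] Y) (r : Y →ₗ[A] X) (h : ∀ x, r (s x) = x)
    [hY : Module.Injective A Y] : Module.Injective A X where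
  out P Q _ _ _ _ i hi φ := by
    obtain ⟨k, hk⟩ := hY.out i hi (s ∘ₗ φ)
    exact ⟨r ∘ₗ k, fun x => by simp [hk, h]⟩

/-- a monomorphism from an injective splits -/
theorem split_inj {X Y : Type u} [AddCommGroup X] [Module A X] [AddCommGroup Y] [Module A Y]
    [hX : Module.Injective A X] (s : X →ₗ[A] Y) (h : Function.Injective s) :
    ∃ r : Y →ₗ[A] X, ∀ x, r (s x) = x := by
  obtain ⟨k, hk⟩ := hX.out s h LinearMap.id
  exact ⟨k, hk⟩
end

end Tilt

namespace Tilt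

section
variable {A : Type u} [Ring A]

/-- finitely generated of projective dimension at most `n` -/
def FP (n : ℕ) (X : ModuleCat.{u} A) : Prop :=
  Module.Finite A X ∧ HasProjectiveDimensionLT X (n+1)

theorem FP.mono {n k : ℕ} (h : n ≤ k) {X : ModuleCat.{u} A} (hX : FP n X) : FP k X :=
  ⟨hX.1, have := hX.2; hasProjectiveDimensionLT_of_ge X (n+1) (k+1) (by omega)⟩

theorem FP.proj {X : ModuleCat.{u} A} (hX : FP 0 X) : Module.Projective A X := by
  have h : HasProjectiveDimensionLT X 1 := hX.2
  have : Projective X := projective_iff_hasProjectiveDimensionLT_one.2 h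
  exact ModuleCat.projective_of_module_projective X

theorem fp_zero (X : ModuleCat.{u} A) [Module.Finite A X] [Module.Projective A X] : FP 0 X := by
  refine ⟨inferInstance, ?_⟩
  have : Projective X := ModuleCat.projective_of_categoryTheory_projective X
  exact (inferInstance : HasProjectiveDimensionLT X 1)

theorem exists_cover (X : ModuleCat.{u} A) (h : Module.Finite A X) :
    ∃ (Q : ModuleCat.{u} A) (p : Q →ₗ[A] X), FP 0 Q ∧ Function.Surjective p := by
  obtain ⟨n, f, hf⟩ := Module.Finite.exists_fin' A X
  exact ⟨ModuleCat.of A (Fin n → A), f, fp_zero _, hf⟩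

theorem ses_ker {Q X : ModuleCat.{u} A} (p : Q →ₗ[A] X) (hp : Function.Surjective p) :
    SES (X := ModuleCat.of A (LinearMap.ker p)) (LinearMap.ker p).subtype p :=
  ⟨Subtype.val_injective, LinearMap.exact_subtype_ker_map p, hp⟩

theorem fp_ker [IsNoetherianRing A] {n : ℕ} {Q X : ModuleCat.{u} A} (p : Q →ₗ[A] X)
    (hp : Function.Surjective p) (hQ : FP 0 Q) (hX : FP (n+1) X) :
    FP n (ModuleCat.of A (LinearMap.ker p)) := by
  have := hQ.1
  refine ⟨inferInstanceAs (Module.Finite A (LinearMap.ker p)), ?_⟩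
  exact (ses_ker p hp).pd1 (hQ.mono (Nat.zero_le n)).2 hX.2

/-- additivity on short exact sequences -/
def Additive {G : Type*} [AddCommGroup G] (n : ℕ) (χ : ModuleCat.{u} A → G) : Prop :=
  ∀ (X Y Z : ModuleCat.{u} A) (f : X →ₗ[A] Y) (g : Y →ₗ[A] Z), SES f g →
    FP n X → FP n Y → FP n Z → χ Y = χ X + χ Z

theorem schanuel [IsNoetherianRing A] {G : Type*} [AddCommGroup G] {n : ℕ}
    {χ : ModuleCat.{u} A → G} (hχ : Additive n χ) {X : ModuleCat.{u} A} (hX : FP (n+1) X)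
    {Q Q' : ModuleCat.{u} A} (p : Q →ₗ[A] X) (p' : Q' →ₗ[A] X) (hQ : FP 0 Q) (hQ' : FP 0 Q')
    (hp : Function.Surjective p) (hp' : Function.Surjective p') :
    χ Q - χ (ModuleCat.of A (LinearMap.ker p)) = χ Q' - χ (ModuleCat.of A (LinearMap.ker p')) := by
  let B : Submodule A (Q × Q') :=
    LinearMap.ker (p ∘ₗ LinearMap.fst A Q Q' - p' ∘ₗ LinearMap.snd A Q Q')
  have hB : ∀ x : Q × Q', x ∈ B ↔ p x.1 = p' x.2 := fun x => by
    simp [B, sub_eq_zero]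
  let i' : LinearMap.ker p' →ₗ[A] B :=
    { toFun := fun x => ⟨(0, x), by rw [hB]; simp⟩
      map_add' := fun x y => by ext <;> simp
      map_smul' := fun a x => by ext <;> simp }
  let i : LinearMap.ker p →ₗ[A] B :=
    { toFun := fun x => ⟨(x, 0), by rw [hB]; simp⟩
      map_add' := fun x y => by ext <;> simp
      map_smul' := fun a x => by ext <;> simp }
  have s' : SES (X := ModuleCat.of A (LinearMap.ker p')) (Y := ModuleCat.of A B) (Z := Q) i'
      (LinearMap.fst A Q Q' ∘ₗ B.subtype) := by
    refine ⟨?_, ?_, ?_⟩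
    · intro x y h
      have := congrArg (fun t : B => t.1.2) h
      exact Subtype.ext this
    · rintro ⟨⟨a, b⟩, h⟩
      constructor
      · intro h0
        change a = 0 at h0
        subst h0
        have hb := (hB _).1 h
        exact ⟨⟨b, by simpa using hb.symm⟩, rfl⟩
      · rintro ⟨x, hx⟩
        rw [← hx]; rfl
    · intro q
      obtain ⟨q', hq'⟩ := hp' (p q)
      exact ⟨⟨(q, q'), (hB _).2 hq'.symm⟩, rfl⟩
  have s : SES (X := ModuleCat.of A (LinearMap.ker p)) (Y := ModuleCat.of A B) (Z := Q') i
      (LinearMap.snd A Q Q' ∘ₗ B.subtype) := by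
    refine ⟨?_, ?_, ?_⟩
    · intro x y h
      have := congrArg (fun t : B => t.1.1) h
      exact Subtype.ext this
    · rintro ⟨⟨a, b⟩, h⟩
      constructor
      · intro h0
        change b = 0 at h0
        subst h0
        have hb := (hB _).1 h
        exact ⟨⟨a, by simpa using hb⟩, rfl⟩
      · rintro ⟨x, hx⟩
        rw [← hx]; rfl
    · intro q
      obtain ⟨q', hq'⟩ := hp (p' q)
      exact ⟨⟨(q', q), (hB _).2 hq'⟩, rfl⟩
  have k := fp_ker p hp hQ hX
  have k' := fp_ker p' hp' hQ' hX
  have hn := hQ.mono (Nat.zero_le n)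
  have hn' := hQ'.mono (Nat.zero_le n)
  have hBf : FP n (ModuleCat.of A B) := by
    have := hQ.1
    have := hQ'.1
    refine ⟨inferInstanceAs (Module.Finite A B), s'.pd2 k'.2 hn.2⟩
  have e1 := hχ _ _ _ _ _ s' k' hBf hn
  have e2 := hχ _ _ _ _ _ s k hBf hn'
  rw [e1] at e2
  rw [sub_eq_sub_iff_add_eq_add, add_comm, e2, add_comm]

theorem horseshoe [IsNoetherianRing A] {G : Type*} [AddCommGroup G] {n : ℕ}
    {χ : ModuleCat.{u} A → G} (hχ : Additive n χ) {X Y Z : ModuleCat.{u} A}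
    (hX : FP (n+1) X) (hY : FP (n+1) Y) (hZ : FP (n+1) Z)
    (f : X →ₗ[A] Y) (g : Y →ₗ[A] Z) (hfg : SES f g)
    {Q Q' : ModuleCat.{u} A} (p : Q →ₗ[A] X) (r : Q' →ₗ[A] Z) (hQ : FP 0 Q) (hQ' : FP 0 Q')
    (hp : Function.Surjective p) (hr : Function.Surjective r) :
    ∃ (Q'' : ModuleCat.{u} A) (q : Q'' →ₗ[A] Y), FP 0 Q'' ∧ Function.Surjective q ∧
      χ Q'' - χ (ModuleCat.of A (LinearMap.ker q)) =
      (χ Q - χ (ModuleCat.of A (LinearMap.ker p))) +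
      (χ Q' - χ (ModuleCat.of A (LinearMap.ker r))) := by
  have := hQ.1
  have := hQ'.1
  have := hQ.proj
  have := hQ'.proj
  obtain ⟨t, ht⟩ := Module.projective_lifting_property g r hfg.2.2
  have ht' : ∀ b, g (t b) = r b := fun b => DFunLike.congr_fun ht b
  have hgf : ∀ x, g (f x) = 0 := hfg.2.1.apply_apply_eq_zero
  let q : (Q × Q') →ₗ[A] Y := (f ∘ₗ p).coprod t
  have hq : ∀ a b, q (a, b) = f (p a) + t b := fun a b => rfl
  have hqs : Function.Surjective q := by
    intro y
    obtain ⟨b, hb⟩ := hr (g y)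
    have : g (y - t b) = 0 := by rw [map_sub, ht', hb, sub_self]
    obtain ⟨x, hx⟩ := (hfg.2.1 _).1 this
    obtain ⟨a, rfl⟩ := hp x
    exact ⟨(a, b), by rw [hq, hx]; abel⟩
  have hQQ : FP 0 (ModuleCat.of A (Q × Q')) := fp_zero _
  refine ⟨ModuleCat.of A (Q × Q'), q, hQQ, hqs, ?_⟩
  have s0 : SES (Y := ModuleCat.of A (Q × Q')) (LinearMap.inl A Q Q') (LinearMap.snd A Q Q') :=
    ⟨LinearMap.inl_injective, .inl_snd, LinearMap.snd_surjective⟩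
  have e0 := hχ _ _ _ _ _ s0 (hQ.mono (Nat.zero_le n)) (hQQ.mono (Nat.zero_le n))
    (hQ'.mono (Nat.zero_le n))
  let i : LinearMap.ker p →ₗ[A] LinearMap.ker q :=
    { toFun := fun x => ⟨(x, 0), by simp [hq]⟩
      map_add' := fun x y => by ext <;> simp
      map_smul' := fun a x => by ext <;> simp }
  let j : LinearMap.ker q →ₗ[A] LinearMap.ker r :=
    { toFun := fun x => ⟨x.1.2, by
        have h := x.2
        rw [LinearMap.mem_ker] at h
        have h2 := congrArg g h
        rw [show x.1 = (x.1.1, x.1.2) from rfl, hq, map_add, hgf, ht', zero_add, map_zero] at h2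
        exact h2⟩
      map_add' := fun x y => by ext; simp
      map_smul' := fun a x => by ext; simp }
  have s1 : SES (X := ModuleCat.of A (LinearMap.ker p)) (Y := ModuleCat.of A (LinearMap.ker q))
      (Z := ModuleCat.of A (LinearMap.ker r)) i j := by
    refine ⟨?_, ?_, ?_⟩
    · intro x y h
      have := congrArg (fun t : LinearMap.ker q => t.1.1) h
      exact Subtype.ext this
    · rintro ⟨⟨a, b⟩, h⟩
      constructor
      · intro h0
        have h0 : b = 0 := congrArg Subtype.val h0
        subst h0
        rw [LinearMap.mem_ker, hq, map_zero, add_zero] at h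
        exact ⟨⟨a, hfg.1 (by rw [h, map_zero])⟩, rfl⟩
      · rintro ⟨x, hx⟩
        rw [← hx]; rfl
    · rintro ⟨b, hb⟩
      have : g (- t b) = 0 := by rw [map_neg, ht', LinearMap.mem_ker.1 hb, neg_zero]
      obtain ⟨x, hx⟩ := (hfg.2.1 _).1 this
      obtain ⟨a, rfl⟩ := hp x
      exact ⟨⟨(a, b), by rw [LinearMap.mem_ker, hq, hx]; abel⟩, rfl⟩
  have e1 := hχ _ _ _ _ _ s1 (fp_ker p hp hQ hX) (fp_ker (Q := ModuleCat.of A (Q × Q')) q hqs hQQ hY)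
    (fp_ker r hr hQ' hZ)
  rw [e0, e1]
  abel

theorem exists_chi [IsNoetherianRing A] {G : Type*} [AddCommGroup G] (l : ModuleCat.{u} A → G)
    (hl : Additive 0 l) (n : ℕ) :
    ∃ χ : ModuleCat.{u} A → G, Additive n χ ∧ ∀ X, FP 0 X → χ X = l X := by
  induction n with
  | zero => exact ⟨l, hl, fun _ _ => rfl⟩
  | succ n ih =>
    obtain ⟨χ, hχ, hχl⟩ := ih
    classical
    choose Q p hQ hp using fun X : ModuleCat.{u} A => exists_cover X
    let χ' : ModuleCat.{u} A → G := fun X =>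
      if h : Module.Finite A X then χ (Q X h) - χ (ModuleCat.of A (LinearMap.ker (p X h))) else 0
    have key : ∀ (X R : ModuleCat.{u} A) (q : R →ₗ[A] X), FP (n+1) X → FP 0 R →
        Function.Surjective q → χ' X = χ R - χ (ModuleCat.of A (LinearMap.ker q)) := by
      intro X R q hX hR hq
      have : χ' X = χ (Q X hX.1) - χ (ModuleCat.of A (LinearMap.ker (p X hX.1))) := dif_pos hX.1
      rw [this]
      exact schanuel hχ hX _ _ (hQ _ _) hR (hp _ _) hq
    refine ⟨χ', ?_, ?_⟩
    · intro X Y Z f g hfg hX hY hZ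
      obtain ⟨R, q, hR, hq, e⟩ := horseshoe hχ hX hY hZ f g hfg _ _ (hQ X hX.1) (hQ Z hZ.1)
        (hp X hX.1) (hp Z hZ.1)
      rw [key X _ _ hX (hQ X hX.1) (hp X hX.1), key Z _ _ hZ (hQ Z hZ.1) (hp Z hZ.1),
        key Y _ q hY hR hq, e]
    · intro X hX
      rw [key X X LinearMap.id (hX.mono (Nat.zero_le _)) hX Function.surjective_id, ← hχl X hX]
      have := hX.1
      have k := fp_ker (n := n) (LinearMap.id : X →ₗ[A] X) Function.surjective_id hX
        (hX.mono (Nat.zero_le _))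
      have e := hχ _ _ _ _ _ (ses_ker (LinearMap.id : X →ₗ[A] X) Function.surjective_id) k
        (hX.mono (Nat.zero_le _)) (hX.mono (Nat.zero_le _))
      rw [right_eq_add] at e
      rw [e, sub_zero]

theorem Additive.iso {G : Type*} [AddCommGroup G] {n : ℕ}
    {χ : ModuleCat.{u} A → G} (hχ : Additive n χ) {X Y : ModuleCat.{u} A} (e : X ≃ₗ[A] Y)
    (hX : FP n X) (hY : FP n Y) : χ X = χ Y := by
  let O : ModuleCat.{u} A := ModuleCat.of A PUnit
  have hO : FP n O := (fp_zero O).mono (Nat.zero_le n)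
  have h0 : χ O = 0 := by
    have := hχ O O O 0 0 ⟨fun _ _ _ => rfl, fun x => ⟨fun _ => ⟨x, rfl⟩, fun _ => rfl⟩,
      fun x => ⟨x, rfl⟩⟩ hO hO hO
    rwa [right_eq_add] at this
  have := hχ O X Y 0 e.toLinearMap ⟨fun _ _ _ => rfl, fun x => ⟨fun h => ⟨0, ?_⟩, ?_⟩,
      e.surjective⟩ hO hX hY
  · rw [this, h0, zero_add]
  · have : x = 0 := by simpa using h
    simp [this]
  · rintro ⟨y, rfl⟩; simp

end

end Tilt

namespace Tilt

section
variable {A : Type u} [Ring A]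

theorem finset_inf {X : Type u} [AddCommGroup X] [Module A X] [IsArtinian A X] {κ : Type*}
    (N : κ → Submodule A X) : ∃ F : Finset κ, ∀ k, F.inf N ≤ N k := by
  classical
  obtain ⟨_, ⟨F, rfl⟩, hF⟩ := IsArtinian.set_has_minimal (Set.range fun F : Finset κ => F.inf N)
    ⟨_, ∅, rfl⟩
  refine ⟨F, fun k => ?_⟩
  have h := hF ((insert k F).inf N) ⟨_, rfl⟩
  have hle : (insert k F).inf N ≤ F.inf N := Finset.inf_mono (Finset.subset_insert k F)
  have heq := eq_of_le_of_not_lt hle h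
  rw [← heq]
  exact Finset.inf_le (Finset.mem_insert_self k F)

theorem embed {X T : Type u} [AddCommGroup X] [Module A X] [IsArtinian A X]
    [AddCommGroup T] [Module A T] [hT : Module.Injective A T]
    (h : ∀ S : Submodule A X, IsSimpleModule A S → ∃ g : S →ₗ[A] T, g ≠ 0) :
    ∃ (n : ℕ) (f : X →ₗ[A] (Fin n → T)), Function.Injective f := by
  obtain ⟨F, hF⟩ := finset_inf (fun k : X →ₗ[A] T => LinearMap.ker k)
  have hbot : F.inf (fun k : X →ₗ[A] T => LinearMap.ker k) = ⊥ := by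
    rcases IsAtomic.eq_bot_or_exists_atom_le (F.inf (fun k : X →ₗ[A] T => LinearMap.ker k)) with
      h0 | ⟨S, hS, hle⟩
    · exact h0
    · exfalso
      obtain ⟨g, hg⟩ := h S (isSimpleModule_iff_isAtom.2 hS)
      obtain ⟨k, hk⟩ := hT.out S.subtype S.injective_subtype g
      apply hg
      ext x
      rw [← hk]
      exact (hle.trans (hF k)) x.2
  refine ⟨F.card, LinearMap.pi fun i => (F.equivFin.symm i).1, ?_⟩
  rw [injective_iff_map_eq_zero]
  intro x hx
  have : x ∈ F.inf (fun k : X →ₗ[A] T => LinearMap.ker k) := by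
    rw [Submodule.mem_finsetInf]
    intro k hk
    have := congrFun hx (F.equivFin ⟨k, hk⟩)
    simpa using this
  rw [hbot] at this
  simpa using this

theorem fitting {P : Type u} [AddCommGroup P] [Module A P] [IsArtinian A P] [IsNoetherian A P]
    (φ : P →ₗ[A] P) : ∃ (n : ℕ) (π : P →ₗ[A] P), (∀ x, ∃ y, π x = (φ ^ (n+1)) y) ∧
      (∀ y, π ((φ ^ (n+1)) y) = (φ ^ (n+1)) y) := by
  obtain ⟨k, hk⟩ := Filter.eventually_atTop.mp
    (LinearMap.eventually_isCompl_ker_pow_range_pow φ)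
  have h := (hk (k+1) (Nat.le_succ k)).symm
  refine ⟨k, (LinearMap.range (φ ^ (k+1))).subtype ∘ₗ Submodule.projectionOnto _ _ h, ?_, ?_⟩
  · intro x
    obtain ⟨y, hy⟩ := (Submodule.projectionOnto _ _ h x).2
    exact ⟨y, hy.symm⟩
  · intro y
    exact congrArg Subtype.val
      (Submodule.projectionOnto_apply_left h ⟨(φ ^ (k+1)) y, ⟨y, rfl⟩⟩)

theorem min_idem {M : Type u} [AddCommGroup M] [Module A M] [IsArtinian A M]
    (Φ : (M →ₗ[A] M) → Prop) (h : ∃ e, (∀ x, e (e x) = e x) ∧ Φ e) :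
    ∃ e, (∀ x, e (e x) = e x) ∧ Φ e ∧ ∀ e', (∀ x, e' (e' x) = e' x) → Φ e' →
      LinearMap.range e' ≤ LinearMap.range e → LinearMap.range e' = LinearMap.range e := by
  obtain ⟨e0, h0, h0'⟩ := h
  obtain ⟨_, ⟨e, ⟨he, he'⟩, rfl⟩, hmin⟩ := IsArtinian.set_has_minimal
    ((fun e : M →ₗ[A] M => LinearMap.range e) '' {e | (∀ x, e (e x) = e x) ∧ Φ e})
    ⟨_, e0, ⟨h0, h0'⟩, rfl⟩
  exact ⟨e, he, he', fun e' h1 h2 hle => eq_of_le_of_not_lt hle (hmin _ ⟨e', ⟨h1, h2⟩, rfl⟩)⟩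

/-- minimal injective over `S` -/
def MinInj {S E : Type u} [AddCommGroup S] [Module A S] [AddCommGroup E] [Module A E]
    (i : S →ₗ[A] E) : Prop :=
  Function.Injective i ∧ Module.Injective A E ∧
    ∀ π : E →ₗ[A] E, (∀ x, π (π x) = π x) → (∀ s, π (i s) = i s) → ∀ x, π x = x

theorem exists_minInj {S X : Type u} [AddCommGroup S] [Module A S] [AddCommGroup X] [Module A X]
    [IsArtinian A X] [Module.Injective A X] (i : S →ₗ[A] X) (hi : Function.Injective i) :
    ∃ (e : X →ₗ[A] X) (j : S →ₗ[A] LinearMap.range e), (∀ x, e (e x) = e x) ∧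
      (∀ s, (j s : X) = i s) ∧ MinInj j := by
  obtain ⟨e, he, hΦ, hmin⟩ := min_idem (fun e : X →ₗ[A] X => ∀ s, e (i s) = i s)
    ⟨LinearMap.id, fun _ => rfl, fun _ => rfl⟩
  have hfix : ∀ x : LinearMap.range e, e x = x := by
    rintro ⟨_, y, rfl⟩; exact he y
  refine ⟨e, i.codRestrict _ (fun s => ⟨i s, hΦ s⟩), he, fun s => rfl, ?_, ?_, ?_⟩
  · intro a b h
    exact hi (congrArg Subtype.val h)
  · exact inj_of_retract (LinearMap.range e).subtype e.rangeRestrict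
      (fun x => Subtype.ext (hfix x))
  · intro π hπ hπi x
    let e' : X →ₗ[A] X := (LinearMap.range e).subtype ∘ₗ π ∘ₗ e.rangeRestrict
    have hrr : ∀ x : LinearMap.range e, e.rangeRestrict x = x := fun x => Subtype.ext (hfix x)
    have h1 := hmin e' (fun x => by simp [e', hrr, hπ])
      (fun s => by
        have := hπi s
        have h2 : e.rangeRestrict (i s) =
            i.codRestrict (LinearMap.range e) (fun s => ⟨i s, hΦ s⟩) s :=
          Subtype.ext (hΦ s)
        change ((π (e.rangeRestrict (i s)) : LinearMap.range e) : X) = i s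
        rw [h2, this]; rfl)
      (by rintro _ ⟨y, rfl⟩; exact (π (e.rangeRestrict y)).2)
    have hx : (x : X) ∈ LinearMap.range e' := by rw [h1]; exact x.2
    obtain ⟨y, hy⟩ := hx
    have hx' : x = π (e.rangeRestrict y) := Subtype.ext hy.symm
    rw [hx', hπ]

theorem MinInj.endo {S E : Type u} [AddCommGroup S] [Module A S] [AddCommGroup E] [Module A E]
    [IsArtinian A E] [IsNoetherian A E] {i : S →ₗ[A] E} (h : MinInj i) (φ : E →ₗ[A] E)
    (hφ : ∀ s, φ (i s) = i s) : Function.Bijective φ := by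
  obtain ⟨n, π, h1, h2⟩ := fitting φ
  have hpow : ∀ n s, (φ ^ n) (i s) = i s := by
    intro n s
    induction n with
    | zero => rfl
    | succ n ih => rw [pow_succ, Module.End.mul_apply, hφ, ih]
  have hid := h.2.2 π (fun x => by obtain ⟨y, hy⟩ := h1 x; rw [hy, h2])
    (fun s => by rw [← hpow (n+1) s, h2])
  have hs : Function.Surjective φ := by
    intro x
    obtain ⟨y, hy⟩ := h1 x
    rw [hid, pow_succ'] at hy
    exact ⟨_, hy.symm⟩
  exact ⟨IsNoetherian.injective_of_surjective_endomorphism φ hs, hs⟩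

theorem MinInj.unique {S E E' : Type u} [AddCommGroup S] [Module A S] [AddCommGroup E] [Module A E]
    [AddCommGroup E'] [Module A E']
    [IsArtinian A E] [IsNoetherian A E] [IsArtinian A E'] [IsNoetherian A E']
    {i : S →ₗ[A] E} (h : MinInj i) {i' : S →ₗ[A] E'} (h' : MinInj i') : Nonempty (E ≃ₗ[A] E') := by
  obtain ⟨a, ha⟩ := h'.2.1.out i h.1 i'
  obtain ⟨b, hb⟩ := h.2.1.out i' h'.1 i
  have h1 := h.endo (b ∘ₗ a) (fun s => by simp [ha, hb])
  have h2 := h'.endo (a ∘ₗ b) (fun s => by simp [ha, hb])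
  exact ⟨LinearEquiv.ofBijective a ⟨fun x y hxy => h1.1 (by simp [hxy]),
    fun x => by obtain ⟨y, hy⟩ := h2.2 x; exact ⟨b y, hy⟩⟩⟩

theorem exists_proj [IsArtinianRing A] [IsNoetherianRing A] (S : Type u) [AddCommGroup S]
    [Module A S] [IsSimpleModule A S] :
    ∃ e : A →ₗ[A] A, (∀ x, e (e x) = e x) ∧ (∃ p : LinearMap.range e →ₗ[A] S, p ≠ 0) ∧
      ∀ (T : Type u) [AddCommGroup T] [Module A T] [IsSimpleModule A T]
        (q : LinearMap.range e →ₗ[A] T), q ≠ 0 → Nonempty (T ≃ₗ[A] S) := by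
  obtain ⟨e, he, ⟨p0, hp0⟩, hmin⟩ := min_idem
    (fun e : A →ₗ[A] A => ∃ p : A →ₗ[A] S, p ∘ₗ e ≠ 0) (by
      have := IsSimpleModule.nontrivial A S
      obtain ⟨s, hs⟩ := exists_ne (0 : S)
      refine ⟨LinearMap.id, fun _ => rfl, LinearMap.toSpanSingleton A S s, fun h => hs ?_⟩
      have := DFunLike.congr_fun h 1
      simpa using this)
  have hfix : ∀ x : LinearMap.range e, e x = x := by
    rintro ⟨_, y, rfl⟩; exact he y
  have hrr : ∀ x : LinearMap.range e, e.rangeRestrict x = x := fun x => Subtype.ext (hfix x)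
  have hproj : Module.Projective A (LinearMap.range e) :=
    Module.Projective.of_split (LinearMap.range e).subtype e.rangeRestrict
      (LinearMap.ext hrr)
  have hp : p0 ∘ₗ (LinearMap.range e).subtype ≠ 0 := by
    intro h
    apply hp0
    ext
    exact DFunLike.congr_fun h (e.rangeRestrict 1)
  refine ⟨e, he, ⟨_, hp⟩, ?_⟩
  intro T _ _ _ q hq
  by_contra hT
  set p := p0 ∘ₗ (LinearMap.range e).subtype with hpdef
  have hqs := LinearMap.surjective_of_ne_zero hq
  have hnot : ¬ LinearMap.ker q ≤ LinearMap.ker p := by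
    intro hle
    let r : T →ₗ[A] S := ((LinearMap.ker q).liftQ p hle) ∘ₗ
      (q.quotKerEquivOfSurjective hqs).symm.toLinearMap
    have hr : ∀ x, r (q x) = p x := by
      intro x
      have : (q.quotKerEquivOfSurjective hqs).symm (q x) = (LinearMap.ker q).mkQ x := by
        rw [LinearEquiv.symm_apply_eq]; rfl
      simp [r, this]
    have hr0 : r ≠ 0 := by
      intro h0
      apply hp
      ext x
      rw [← hr, h0]; rfl
    exact hT ⟨LinearEquiv.ofBijective r (LinearMap.bijective_of_ne_zero hr0)⟩
  have hps : Function.Surjective (p ∘ₗ (LinearMap.ker q).subtype) := by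
    apply LinearMap.surjective_of_ne_zero
    intro h0
    apply hnot
    intro x hx
    exact DFunLike.congr_fun h0 ⟨x, hx⟩
  have hpq : Function.Surjective (p.prod q) := by
    rintro ⟨s, t⟩
    obtain ⟨x, hx⟩ := hqs t
    obtain ⟨y, hy⟩ := hps (s - p x)
    refine ⟨x + y, ?_⟩
    have h1 : p (y : LinearMap.range e) = s - p x := hy
    have h2 : q (y : LinearMap.range e) = 0 := y.2
    refine Prod.ext ?_ ?_
    · change p (x + y) = s
      rw [map_add, h1]; abel
    · change q (x + y) = t
      rw [map_add, h2, hx, add_zero]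
  obtain ⟨φ, hφ⟩ := Module.projective_lifting_property (p.prod q)
    ((LinearMap.inl A S T) ∘ₗ p) hpq
  have hφp : ∀ x, p (φ x) = p x := fun x => congrArg Prod.fst (DFunLike.congr_fun hφ x)
  have hφq : ∀ x, q (φ x) = 0 := fun x => congrArg Prod.snd (DFunLike.congr_fun hφ x)
  have hpow : ∀ n x, p ((φ ^ n) x) = p x := by
    intro n x
    induction n with
    | zero => rfl
    | succ n ih => rw [pow_succ', Module.End.mul_apply, hφp, ih]
  obtain ⟨n, π, h1, h2⟩ := fitting φ
  have hππ : ∀ x, π (π x) = π x := fun x => by obtain ⟨y, hy⟩ := h1 x; rw [hy, h2]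
  have hqπ : ∀ x, q (π x) = 0 := fun x => by
    obtain ⟨y, hy⟩ := h1 x; rw [hy, pow_succ', Module.End.mul_apply, hφq]
  let e' : A →ₗ[A] A := (LinearMap.range e).subtype ∘ₗ π ∘ₗ e.rangeRestrict
  have hr := hmin e' (fun x => by simp [e', hrr, hππ]) ⟨p0, by
      intro h0
      apply hp
      ext x
      have := DFunLike.congr_fun h0 (((φ ^ (n+1)) x : LinearMap.range e) : A)
      change p (π (e.rangeRestrict (((φ ^ (n+1)) x : LinearMap.range e) : A))) = 0 at this
      rw [hrr, h2, hpow] at this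
      exact this⟩
    (by rintro _ ⟨y, rfl⟩; exact (π (e.rangeRestrict y)).2)
  apply hq
  ext x
  have hx : (x : A) ∈ LinearMap.range e' := by rw [hr]; exact x.2
  obtain ⟨y, hy⟩ := hx
  have hx' : x = π (e.rangeRestrict y) := Subtype.ext hy.symm
  rw [hx', hqπ]; rfl

theorem exists_simples [IsArtinianRing A] [IsNoetherianRing A] :
    ∃ (ι : Type u) (_ : Fintype ι) (M : ι → Submodule A A),
      (∀ i, IsSimpleModule A (A ⧸ M i)) ∧
      (∀ i j, Nonempty ((A ⧸ M i) ≃ₗ[A] (A ⧸ M j)) → i = j) ∧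
      ∀ (S : Type u) [AddCommGroup S] [Module A S] [IsSimpleModule A S],
        ∃ i, Nonempty (S ≃ₗ[A] (A ⧸ M i)) := by
  classical
  obtain ⟨F, hF⟩ := finset_inf (fun k : {M : Submodule A A // IsCoatom M} => k.1)
  let s : Setoid F :=
    { r := fun i j => Nonempty ((A ⧸ i.1.1) ≃ₗ[A] (A ⧸ j.1.1))
      iseqv := ⟨fun i => ⟨LinearEquiv.refl A _⟩, fun ⟨e⟩ => ⟨e.symm⟩, fun ⟨e⟩ ⟨e'⟩ => ⟨e.trans e'⟩⟩ }
  refine ⟨Quotient s, Fintype.ofFinite _, fun i => i.out.1.1, ?_, ?_, ?_⟩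
  · intro i
    exact isSimpleModule_iff_isCoatom.2 i.out.1.2
  · intro i j h
    rw [← Quotient.out_eq i, ← Quotient.out_eq j]
    exact Quotient.sound h
  · intro S _ _ _
    suffices h : ∃ k : F, Nonempty (S ≃ₗ[A] (A ⧸ k.1.1)) by
      obtain ⟨k, ⟨e⟩⟩ := h
      obtain ⟨e'⟩ : Nonempty _ := Quotient.mk_out (s := s) k
      exact ⟨Quotient.mk s k, ⟨e.trans e'.symm⟩⟩
    by_contra hcon
    push Not at hcon
    obtain ⟨e, he, ⟨p, hp⟩, huniq⟩ := exists_proj (A := A) S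
    have hfix : ∀ x : LinearMap.range e, e x = x := by
      rintro ⟨_, y, rfl⟩; exact he y
    have hproj : Module.Projective A (LinearMap.range e) :=
      Module.Projective.of_split (LinearMap.range e).subtype e.rangeRestrict
        (LinearMap.ext fun x => Subtype.ext (hfix x))
    have := IsSimpleModule.nontrivial A S
    obtain ⟨s0, hs0⟩ := exists_ne (0 : S)
    let t := LinearMap.toSpanSingleton A S s0
    have hts : Function.Surjective t := IsSimpleModule.toSpanSingleton_surjective A hs0
    have hco : IsCoatom (LinearMap.ker t) := LinearMap.isCoatom_ker_of_surjective hts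
    obtain ⟨l, hl⟩ := Module.projective_lifting_property t p hts
    apply hp
    ext x
    rw [← hl]
    apply hF ⟨_, hco⟩
    rw [Submodule.mem_finsetInf]
    intro k hk
    have : IsSimpleModule A (A ⧸ k.1) := isSimpleModule_iff_isCoatom.2 k.2
    have h0 : k.1.mkQ ∘ₗ l = 0 := by
      by_contra hne
      obtain ⟨e'⟩ := huniq _ _ hne
      exact (hcon ⟨k, hk⟩).elim' e'.symm
    have := DFunLike.congr_fun h0 x
    simpa using this

end

theorem hull_finite (R₀ : Type u) [CommRing R₀] [IsArtinianRing R₀]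
    (A : Type u) [Ring A] [Algebra R₀ A] [Module.Finite R₀ A] [IsArtinianRing A]
    [IsNoetherianRing A]
    {M I : Type u} [AddCommGroup M] [Module A M]
    [AddCommGroup I] [Module A I] [Module.Finite A M] (f : M →ₗ[A] I)
    (hf : IsInjHull A f) : Module.Finite A I := by
  let _ : Module R₀ I := Module.compHom I (algebraMap R₀ A)
  let _ : Module R₀ M := Module.compHom M (algebraMap R₀ A)
  have : IsScalarTower R₀ A I := IsScalarTower.of_algebraMap_smul fun _ _ => rfl
  have : IsScalarTower R₀ A M := IsScalarTower.of_algebraMap_smul fun _ _ => rfl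
  have : SMulCommClass A R₀ I := IsScalarTower.to_smulCommClass'
  have : Module.Finite R₀ M := Module.Finite.trans A M
  have hsimple : ∀ (S : Type u) [AddCommGroup S] [Module A S] [IsSimpleModule A S],
      IsNoetherian R₀ (S →ₗ[A] I) := by
    intro S _ _ _
    have := IsSimpleModule.nontrivial A S
    obtain ⟨s, hs⟩ := exists_ne (0 : S)
    have hmem : ∀ h : S →ₗ[A] I, h s ∈ (LinearMap.range f).restrictScalars R₀ := by
      intro h
      by_cases h0 : h = 0
      · simp [h0]
      · have hinj := LinearMap.injective_of_ne_zero h0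
        have hs' : IsSimpleModule A (LinearMap.range h) :=
          IsSimpleModule.congr (LinearEquiv.ofInjective h hinj).symm
        have hat : IsAtom (LinearMap.range h) := isSimpleModule_iff_isAtom.1 hs'
        have hne := hf.2.2 (LinearMap.range h) hat.1
        have := (hat.le_iff.1 (inf_le_left : LinearMap.range h ⊓ LinearMap.range f ≤ _)).resolve_left
          hne
        have hle : LinearMap.range h ≤ LinearMap.range f := inf_eq_left.1 this
        exact hle ⟨s, rfl⟩
    let ev : (S →ₗ[A] I) →ₗ[R₀] ((LinearMap.range f).restrictScalars R₀) :=
      { toFun := fun h => ⟨h s, hmem h⟩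
        map_add' := fun _ _ => rfl
        map_smul' := fun _ _ => rfl }
    have hr : Function.Surjective (f.restrictScalars R₀).rangeRestrict :=
      LinearMap.surjective_rangeRestrict _
    have hN : IsNoetherian R₀ (LinearMap.range (f.restrictScalars R₀)) := inferInstance
    have hN' : IsNoetherian R₀ ((LinearMap.range f).restrictScalars R₀) := hN
    refine isNoetherian_of_injective ev ?_
    intro a b hab
    have hab' : a s = b s := congrArg Subtype.val hab
    ext x
    obtain ⟨c, rfl⟩ := IsSimpleModule.toSpanSingleton_surjective A hs x
    simp [hab']
  have hall : ∀ (X : Type u) [AddCommGroup X] [Module A X], IsFiniteLength A X →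
      IsNoetherian R₀ (X →ₗ[A] I) := by
    intro X _ _ hX
    induction hX with
    | of_subsingleton => infer_instance
    | @of_simple_quotient X _ _ N _ _ ih =>
      let a : ((X ⧸ N) →ₗ[A] I) →ₗ[R₀] (X →ₗ[A] I) :=
        { toFun := fun h => h ∘ₗ N.mkQ
          map_add' := fun _ _ => rfl
          map_smul' := fun _ _ => rfl }
      let b : (X →ₗ[A] I) →ₗ[R₀] (N →ₗ[A] I) :=
        { toFun := fun h => h ∘ₗ N.subtype
          map_add' := fun _ _ => rfl
          map_smul' := fun _ _ => rfl }
      have := hsimple (X ⧸ N)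
      refine isNoetherian_of_range_eq_ker a b ?_
      ext h
      constructor
      · rintro ⟨k, rfl⟩
        rw [LinearMap.mem_ker]
        ext x
        have : N.mkQ (x : X) = 0 := by simp
        change k (N.mkQ (x : X)) = 0
        rw [this, map_zero]
      · intro hh
        have hle : N ≤ LinearMap.ker h := fun x hx => by
          have := DFunLike.congr_fun (LinearMap.mem_ker.1 hh) ⟨x, hx⟩
          exact this
        exact ⟨N.liftQ h hle, by ext x; simp [a]⟩
  have hA : IsFiniteLength A A := isFiniteLength_iff_isNoetherian_isArtinian.2 ⟨inferInstance, inferInstance⟩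
  have h1 := hall A hA
  let ev1 : (A →ₗ[A] I) →ₗ[R₀] I :=
    { toFun := fun h => h 1
      map_add' := fun _ _ => rfl
      map_smul' := fun _ _ => rfl }
  have : Module.Finite R₀ I := Module.Finite.of_surjective ev1 (fun x =>
    ⟨LinearMap.toSpanSingleton A I x, by simp [ev1]⟩)
  exact Module.Finite.of_restrictScalars_finite R₀ A I

end Tilt

namespace Tilt

section
variable (R₀ : Type u) [CommRing R₀] [IsArtinianRing R₀] {A : Type u} [Ring A]
  (V : Type u) [AddCommGroup V] [Module A V] [Module R₀ V] [SMulCommClass A R₀ V]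
  [Module.Finite R₀ V]

theorem hom_finlen (X : ModuleCat.{u} A) [Module.Finite A X] :
    IsFiniteLength R₀ (X →ₗ[A] V) := by
  obtain ⟨n, p, hp⟩ := Module.Finite.exists_fin' A X
  let ev : (X →ₗ[A] V) →ₗ[R₀] (Fin n → V) :=
    { toFun := fun h i => h (p (Pi.single i 1))
      map_add' := fun _ _ => rfl
      map_smul' := fun _ _ => rfl }
  have hev : Function.Injective ev := by
    intro a b hab
    have : a ∘ₗ p = b ∘ₗ p := by
      ext i
      exact congrFun hab i
    ext x
    obtain ⟨y, rfl⟩ := hp x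
    exact DFunLike.congr_fun this y
  have : IsNoetherianRing R₀ := inferInstance
  rw [isFiniteLength_iff_isNoetherian_isArtinian]
  exact ⟨isNoetherian_of_injective ev hev, isArtinian_of_injective ev hev⟩

/-- length of the Hom module as a rational number -/
noncomputable def len (X : ModuleCat.{u} A) : ℚ := ((Module.length R₀ (X →ₗ[A] V)).toNat : ℚ)

theorem len_zero (X : ModuleCat.{u} A) (h : ∀ f : X →ₗ[A] V, f = 0) : len R₀ V X = 0 := by
  have : Subsingleton (X →ₗ[A] V) := ⟨fun a b => by rw [h a, h b]⟩
  simp [len, Module.length_eq_zero_iff.2 this]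

theorem len_ne (X : ModuleCat.{u} A) [Module.Finite A X] (f : X →ₗ[A] V) (hf : f ≠ 0) :
    len R₀ V X ≠ 0 := by
  have h1 := Module.length_ne_top_iff.2 (hom_finlen R₀ V X)
  have h2 : Module.length R₀ (X →ₗ[A] V) ≠ 0 := by
    rw [Ne, Module.length_eq_zero_iff]
    intro h
    exact hf (Subsingleton.elim _ _)
  simp [len, ENat.toNat_eq_zero, h1, h2]

theorem len_additive : Additive (A := A) 0 (len R₀ V) := by
  intro X Y Z f g h hX hY hZ
  have := hX.1
  have := hY.1
  have := hZ.1
  have := hZ.proj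
  obtain ⟨s, hs⟩ := Module.projective_lifting_property g LinearMap.id h.2.2
  have hiff : (Function.Injective f ∧ ∃ l, g ∘ₗ l = LinearMap.id) ↔
      (Function.Surjective g ∧ ∃ l, l ∘ₗ f = LinearMap.id) := h.2.1.split_tfae'.out 0 1
  obtain ⟨-, r, hr⟩ := hiff.1 ⟨h.1, s, hs⟩
  let a : (Z →ₗ[A] V) →ₗ[R₀] (Y →ₗ[A] V) :=
    { toFun := fun k => k ∘ₗ g
      map_add' := fun _ _ => rfl
      map_smul' := fun _ _ => rfl }
  let b : (Y →ₗ[A] V) →ₗ[R₀] (X →ₗ[A] V) :=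
    { toFun := fun k => k ∘ₗ f
      map_add' := fun _ _ => rfl
      map_smul' := fun _ _ => rfl }
  have hs' : ∀ z, g (s z) = z := fun z => DFunLike.congr_fun hs z
  have hr' : ∀ x, r (f x) = x := fun x => DFunLike.congr_fun hr x
  have e := Module.length_eq_add_of_exact a b
    (by
      intro k k' hk
      ext z
      rw [← hs' z]
      exact DFunLike.congr_fun hk (s z))
    (by
      intro k
      refine ⟨k ∘ₗ r, ?_⟩
      ext x
      change k (r (f x)) = k x
      rw [hr'])
    (by
      intro k
      constructor
      · intro hk
        refine ⟨k ∘ₗ s, ?_⟩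
        ext y
        change k (s (g y)) = k y
        have : g (s (g y) - y) = 0 := by rw [map_sub, hs', sub_self]
        obtain ⟨x, hx⟩ := (h.2.1 _).1 this
        have h2 : k (f x) = 0 := DFunLike.congr_fun hk x
        rw [hx, map_sub] at h2
        exact sub_eq_zero.1 h2
      · rintro ⟨l, rfl⟩
        ext x
        change l (g (f x)) = 0
        rw [h.2.1.apply_apply_eq_zero, map_zero])
  have h1 := Module.length_ne_top_iff.2 (hom_finlen R₀ V X)
  have h2 := Module.length_ne_top_iff.2 (hom_finlen R₀ V Z)
  unfold len
  rw [e, ENat.toNat_add h2 h1]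
  push_cast
  ring
end

end Tilt

namespace Tilt

section
variable {A : Type u} [Ring A]

theorem zero_fp (n : ℕ) (X : ModuleCat.{u} A) [Subsingleton X] : FP n X := by
  have : Module.Free A X := Module.Free.of_subsingleton A X
  have : Module.Projective A X := Module.Projective.of_free
  exact (fp_zero X).mono (Nat.zero_le n)

theorem Additive.zero {G : Type*} [AddCommGroup G] {n : ℕ}
    {χ : ModuleCat.{u} A → G} (hχ : Additive n χ) (X : ModuleCat.{u} A) [Subsingleton X] :
    χ X = 0 := by
  have := hχ X X X 0 0 ⟨fun _ _ _ => Subsingleton.elim _ _,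
    fun x => ⟨fun _ => ⟨x, Subsingleton.elim _ _⟩, fun _ => rfl⟩,
    fun x => ⟨x, Subsingleton.elim _ _⟩⟩ (zero_fp n X) (zero_fp n X) (zero_fp n X)
  simpa using this

theorem pi_fp (b n : ℕ) (T : Fin n → ModuleCat.{u} A) (h : ∀ i, FP b (T i)) :
    FP b (ModuleCat.of A (∀ i, T i)) := by
  induction n with
  | zero =>
    have : Subsingleton (ModuleCat.of A (∀ i, T i)) :=
      inferInstanceAs (Subsingleton (∀ i : Fin 0, T i))
    exact zero_fp b _
  | succ n ih =>
    have h1 := ih (fun i => T i.succ) (fun i => h i.succ)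
    have hf : ∀ i, Module.Finite A (T i) := fun i => (h i).1
    refine ⟨inferInstanceAs (Module.Finite A (∀ i, T i)), ?_⟩
    let f : (∀ i : Fin n, T i.succ) →ₗ[A] (∀ i, T i) :=
      { toFun := fun x => Fin.cons 0 x
        map_add' := fun x y => by
          funext i
          refine Fin.cases ?_ (fun j => ?_) i
          · simp
          · simp
        map_smul' := fun a x => by
          funext i
          refine Fin.cases ?_ (fun j => ?_) i
          · simp
          · simp }
    have hs : SES (X := ModuleCat.of A (∀ i : Fin n, T i.succ)) (Y := ModuleCat.of A (∀ i, T i))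
        (Z := T 0) f (LinearMap.proj 0) := by
      refine ⟨?_, ?_, ?_⟩
      · intro x y hxy
        funext i
        have := congrFun hxy i.succ
        exact this
      · intro x
        constructor
        · intro hx
          refine ⟨fun i => x i.succ, ?_⟩
          funext i
          refine Fin.cases ?_ (fun j => ?_) i
          · exact hx.symm
          · rfl
        · rintro ⟨y, rfl⟩
          rfl
      · exact LinearMap.proj_surjective 0
    exact hs.pd2 h1.2 (h 0).2

theorem MinInj.comp {S S' E : Type u} [AddCommGroup S] [Module A S] [AddCommGroup S'] [Module A S']
    [AddCommGroup E] [Module A E] {i : S →ₗ[A] E} (h : MinInj i) (e : S' ≃ₗ[A] S) :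
    MinInj (i ∘ₗ e.toLinearMap) := by
  refine ⟨h.1.comp e.injective, h.2.1, fun π hπ hi x => h.2.2 π hπ (fun s => ?_) x⟩
  have := hi (e.symm s)
  simpa using this

variable [IsArtinianRing A] [IsNoetherianRing A]

theorem fp_of_inj {b : ℕ} {T : ModuleCat.{u} A} [Module.Injective A T] (hT : FP b T)
    (X : ModuleCat.{u} A) [Module.Finite A X] [Module.Injective A X]
    (h : ∀ S : Submodule A X, IsSimpleModule A S → ∃ g : S →ₗ[A] T, g ≠ 0) : FP b X := by
  refine ⟨inferInstance, ?_⟩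
  obtain ⟨n, s, hs⟩ := embed (X := X) (T := T) h
  obtain ⟨r, hr⟩ := split_inj s hs
  exact pd_of_retract (Y := ModuleCat.of A (Fin n → T)) s r hr (pi_fp b n (fun _ => T) (fun _ => hT)).2

theorem inj_chi {G : Type*} [AddCommGroup G] [Module ℚ G] (W : Submodule ℚ G) {b B : ℕ}
    (hb : b ≤ B) {χ : ModuleCat.{u} A → G} (hχ : Additive B χ)
    {T : ModuleCat.{u} A} [Module.Injective A T] (hT : FP b T)
    (hW : ∀ (S E : Type u) [AddCommGroup S] [Module A S] [AddCommGroup E] [Module A E]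
      [IsSimpleModule A S] [Module.Finite A E] (i : S →ₗ[A] E), MinInj i →
      (∃ g : S →ₗ[A] T, g ≠ 0) → χ (ModuleCat.of A E) ∈ W) (n : ℕ) :
    ∀ (X : ModuleCat.{u} A) [Module.Finite A X] [Module.Injective A X],
      (Module.length A X ≤ n) →
      (∀ S : Submodule A X, IsSimpleModule A S → ∃ g : S →ₗ[A] T, g ≠ 0) → χ X ∈ W := by
  induction n with
  | zero =>
    intro X _ _ hn h
    have : Subsingleton X := Module.length_eq_zero_iff.1 (by simpa using hn)
    rw [hχ.zero X]
    exact W.zero_mem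
  | succ n ih =>
    intro X _ _ hn h
    rcases IsAtomic.eq_bot_or_exists_atom_le (⊤ : Submodule A X) with h0 | ⟨S, hS, -⟩
    · have : Subsingleton X := by
        rw [← Submodule.subsingleton_iff A]
        exact subsingleton_of_bot_eq_top h0.symm
      rw [hχ.zero X]
      exact W.zero_mem
    · have hS' : IsSimpleModule A S := isSimpleModule_iff_isAtom.2 hS
      obtain ⟨e, j, he, hj, hmin⟩ := exists_minInj S.subtype S.injective_subtype
      have hfix : ∀ x : LinearMap.range e, e x = x := by
        rintro ⟨_, y, rfl⟩; exact he y
      let Y := ModuleCat.of A (LinearMap.range e)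
      let Z := ModuleCat.of A (LinearMap.ker e)
      have hY : Module.Finite A Y := inferInstanceAs (Module.Finite A (LinearMap.range e))
      have hZ : Module.Finite A Z := inferInstanceAs (Module.Finite A (LinearMap.ker e))
      have hYi : Module.Injective A Y := hmin.2.1
      have hZi : Module.Injective A Z := by
        have hmem : ∀ x : X, ((LinearMap.id : X →ₗ[A] X) - e) x ∈ LinearMap.ker e := fun x => by
          rw [LinearMap.mem_ker]; simp [he]
        refine inj_of_retract (LinearMap.ker e).subtype
          ((LinearMap.id - e).codRestrict (LinearMap.ker e) hmem) ?_
        · rintro ⟨x, hx⟩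
          apply Subtype.ext
          have hx' : e x = 0 := hx
          change x - e x = x
          rw [hx', sub_zero]
      have hses : SES (X := Z) (Y := X) (Z := Y) (LinearMap.ker e).subtype e.rangeRestrict := by
        refine ⟨Subtype.val_injective, ?_, LinearMap.surjective_rangeRestrict e⟩
        intro x
        constructor
        · intro hx
          exact ⟨⟨x, congrArg Subtype.val hx⟩, rfl⟩
        · rintro ⟨y, rfl⟩
          exact Subtype.ext y.2
      have hsub : ∀ (N : Submodule A X) (S : Submodule A N), IsSimpleModule A S →
          ∃ g : S →ₗ[A] T, g ≠ 0 := by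
        intro N S hS
        have eq := S.equivMapOfInjective N.subtype N.injective_subtype
        obtain ⟨g, hg⟩ := h (S.map N.subtype) (IsSimpleModule.congr eq.symm)
        refine ⟨g ∘ₗ eq.toLinearMap, fun h0 => hg ?_⟩
        ext x
        have := DFunLike.congr_fun h0 (eq.symm x)
        simpa using this
      have hl := Module.length_eq_add_of_exact _ _ hses.1 hses.2.2 hses.2.1
      have hpos : 0 < Module.length A Y := by
        rw [Module.length_pos_iff]
        have := IsSimpleModule.nontrivial A S
        exact hmin.1.nontrivial
      have hlen : Module.length A Z ≤ n := by
        rw [hl] at hn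
        have h1 : (1 : ℕ∞) ≤ Module.length A Y := Order.one_le_iff_pos.2 hpos
        have h2 : Module.length A Z + 1 ≤ (n : ℕ∞) + 1 := by
          refine le_trans (add_le_add_right h1 _) ?_
          exact_mod_cast hn
        exact (ENat.add_le_add_iff_right (by simp)).1 h2
      rw [hχ Z X Y _ _ hses ((fp_of_inj hT Z (hsub _)).mono hb) ((fp_of_inj hT X h).mono hb)
        ((fp_of_inj hT Y (hsub _)).mono hb)]
      exact W.add_mem (ih Z hlen (hsub _)) (hW S _ j hmin (h S hS'))

theorem chi_d {G : Type*} [AddCommGroup G] [Module ℚ G] (W : Submodule ℚ G) {b B : ℕ}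
    {χ : ModuleCat.{u} A → G} (hχ : Additive B χ)
    {T : ModuleCat.{u} A} [Module.Injective A T] (hT : FP b T)
    (hW : ∀ (X : ModuleCat.{u} A) [Module.Finite A X] [Module.Injective A X],
      (∀ S : Submodule A X, IsSimpleModule A S → ∃ g : S →ₗ[A] T, g ≠ 0) → χ X ∈ W) (d : ℕ) :
    ∀ (c : ℕ) (X : ModuleCat.{u} A), b ≤ c → c + d ≤ B → FP c X →
      HasInjectiveDimensionLT X (d+1) →
      (∀ S : ModuleCat.{u} A, IsSimpleModule A S → (∀ f : S →ₗ[A] T, f = 0) → Orth S X) →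
      χ X ∈ W := by
  have hsub : ∀ (X : ModuleCat.{u} A), 
      (∀ S : ModuleCat.{u} A, IsSimpleModule A S → (∀ f : S →ₗ[A] T, f = 0) → Orth S X) →
      ∀ S : Submodule A X, IsSimpleModule A S → ∃ g : S →ₗ[A] T, g ≠ 0 := by
    intro X hX S hS
    by_contra hcon
    push Not at hcon
    have h0 := (hX (ModuleCat.of A S) hS hcon).hom S.subtype
    have := IsSimpleModule.nontrivial A S
    obtain ⟨s, hs⟩ := exists_ne (0 : S)
    exact hs (Subtype.ext (DFunLike.congr_fun h0 s))
  induction d with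
  | zero =>
    intro c X hc hB hX hid ho
    have := hX.1
    have : Injective X := injective_iff_hasInjectiveDimensionLT_one.2 hid
    have : Module.Injective A X := Module.injective_module_of_injective_object A X
    exact hW X (hsub X ho)
  | succ d ih =>
    intro c X hc hB hX hid ho
    have := hX.1
    obtain ⟨n, s, hs⟩ := embed (X := X) (T := T) (hsub X ho)
    let Y := ModuleCat.of A (Fin n → T)
    have hYi : Module.Injective A Y := inferInstanceAs (Module.Injective A (Fin n → T))
    have hY : FP b Y := pi_fp b n (fun _ => T) (fun _ => hT)
    have hYf := hY.1
    let Z := ModuleCat.of A (Y ⧸ LinearMap.range s)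
    have hses : SES (X := X) (Y := Y) (Z := Z) s (LinearMap.range s).mkQ :=
      ⟨hs, LinearMap.exact_map_mkQ_range s, Submodule.mkQ_surjective _⟩
    have hZ : FP (c+1) Z := ⟨inferInstanceAs (Module.Finite A (Y ⧸ LinearMap.range s)),
      hses.pd3 hX.2 (hY.mono (by omega)).2⟩
    have hYo : Injective Y := Module.injective_object_of_injective_module A Y
    have h1 : χ Z ∈ W := by
      refine ih (c+1) Z (by omega) (by omega) hZ (hses.id3 hid ?_) ?_
      · have : HasInjectiveDimensionLT Y 1 := injective_iff_hasInjectiveDimensionLT_one.1 hYo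
        exact hasInjectiveDimensionLT_of_ge Y 1 (d+1) (by omega)
      · intro S hS hST
        refine hses.orth3 (ho S hS hST) (orth_of_inj fun f => ?_)
        refine LinearMap.ext fun x => ?_
        funext i
        exact DFunLike.congr_fun (hST ((LinearMap.proj i : (Fin n → T) →ₗ[A] T) ∘ₗ f)) x
    have h2 : χ Y ∈ W := by
      refine hW Y ?_
      intro S hS
      by_contra hcon
      push Not at hcon
      have := IsSimpleModule.nontrivial A S
      obtain ⟨x, hx⟩ := exists_ne (0 : S)
      apply hx
      apply Subtype.ext
      funext i
      exact DFunLike.congr_fun (hcon ((LinearMap.proj i : (Fin n → T) →ₗ[A] T) ∘ₗ S.subtype)) x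
    have h3 := hχ X Y Z _ _ hses (hX.mono (by omega)) (hY.mono (by omega)) (hZ.mono (by omega))
    have h4 : χ X = χ Y - χ Z := by rw [h3]; abel
    rw [h4]
    exact W.sub_mem h2 h1
end

end Tilt

namespace Tilt

theorem card_le_of_span {ι κ : Type*} [Fintype ι] [DecidableEq ι] [Fintype κ] (v : κ → ι → ℚ)
    (h : ∀ i, Pi.single i (1 : ℚ) ∈ Submodule.span ℚ (Set.range v)) :
    Fintype.card ι ≤ Fintype.card κ := by
  have hWtop : Submodule.span ℚ (Set.range v) = ⊤ := by
    rw [eq_top_iff]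
    intro x _
    have : x = ∑ i, x i • Pi.single i (1 : ℚ) := by
      funext k
      simp [Finset.sum_apply, Pi.single_apply]
    rw [this]
    exact Submodule.sum_mem _ fun i _ => Submodule.smul_mem _ _ (h i)
  have h1 : Module.finrank ℚ (Submodule.span ℚ (Set.range v)) ≤ Fintype.card κ :=
    finrank_range_le_card _
  rwa [hWtop, finrank_top, Module.finrank_fintype_fun_eq_card] at h1

set_option maxHeartbeats 1000000 in
theorem core (R₀ : Type u) [CommRing R₀] [IsArtinianRing R₀]
    (A : Type u) [Ring A] [Algebra R₀ A] [Module.Finite R₀ A] [IsArtinianRing A]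
    [IsNoetherianRing A] {b d : ℕ} (T : ModuleCat.{u} A) [Module.Injective A T] (hT : FP b T)
    (hid : HasInjectiveDimensionLT (ModuleCat.of A A) (d+1))
    (horth : ∀ S : ModuleCat.{u} A, IsSimpleModule A S → (∀ f : S →ₗ[A] T, f = 0) →
      Orth S (ModuleCat.of A A)) (S : Type u) [AddCommGroup S] [Module A S] [IsSimpleModule A S] :
    ∃ f : S →ₗ[A] T, f ≠ 0 := by
  classical
  by_contra hcon
  push Not at hcon
  have hTf := hT.1
  obtain ⟨ι, _, M, hM, hMinj, hMall⟩ := exists_simples (A := A)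
  have hsc : ∀ i, SMulCommClass A R₀ (A ⧸ M i) := fun i => IsScalarTower.to_smulCommClass'
  have hfin : ∀ i, Module.Finite R₀ (A ⧸ M i) := fun i => 
    Module.Finite.of_surjective ((M i).mkQ.restrictScalars R₀) (Submodule.mkQ_surjective _)
  let l : ModuleCat.{u} A → (ι → ℚ) := fun X i => len R₀ (A ⧸ M i) X
  have hl : Additive 0 l := fun X Y Z f g h hX hY hZ => by
    funext i
    exact len_additive R₀ (A ⧸ M i) X Y Z f g h hX hY hZ
  obtain ⟨χ, hχ, hχl⟩ := exists_chi l hl (b + d)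
  let P : ι → Prop := fun i => ∃ g : (A ⧸ M i) →ₗ[A] T, g ≠ 0
  have hE : ∀ i : {i // P i}, ∃ E : ModuleCat.{u} A, FP b E ∧
      ∃ j : (A ⧸ M i.1) →ₗ[A] E, MinInj j := by
    rintro ⟨i, g, hg⟩
    have := hM i
    obtain ⟨e, j, he, -, hmin⟩ := exists_minInj g (LinearMap.injective_of_ne_zero hg)
    refine ⟨ModuleCat.of A (LinearMap.range e), ⟨inferInstanceAs (Module.Finite A (LinearMap.range e)), ?_⟩,
      j, hmin⟩
    refine pd_of_retract (Y := T) (LinearMap.range e).subtype e.rangeRestrict ?_ hT.2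
    rintro ⟨_, y, rfl⟩
    exact Subtype.ext (he y)
  choose E hEf j hj using hE
  let W : Submodule ℚ (ι → ℚ) := Submodule.span ℚ (Set.range fun i => χ (E i))
  have hW : ∀ (S E : Type u) [AddCommGroup S] [Module A S] [AddCommGroup E] [Module A E]
      [IsSimpleModule A S] [Module.Finite A E] (i : S →ₗ[A] E), MinInj i →
      (∃ g : S →ₗ[A] T, g ≠ 0) → χ (ModuleCat.of A E) ∈ W := by
    intro S E' _ _ _ _ _ _ i hi ⟨g, hg⟩
    obtain ⟨k, ⟨e⟩⟩ := hMall S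
    have hk : P k := ⟨g ∘ₗ e.symm.toLinearMap, fun h0 => hg (by
      ext x
      have := DFunLike.congr_fun h0 (e x)
      simpa using this)⟩
    have hf := (hEf ⟨k, hk⟩).1
    obtain ⟨φ⟩ := (hj ⟨k, hk⟩).unique (hi.comp e.symm)
    have h1 : FP b (ModuleCat.of A E') := ⟨inferInstanceAs (Module.Finite A E'),
      pd_of_retract (Y := E ⟨k, hk⟩) φ.symm.toLinearMap φ.toLinearMap (fun x => by simp)
        (hEf ⟨k, hk⟩).2⟩
    have h2 := hχ.iso (X := E ⟨k, hk⟩) (Y := ModuleCat.of A E') φ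
      ((hEf ⟨k, hk⟩).mono (by omega)) (h1.mono (by omega))
    rw [← h2]
    exact Submodule.subset_span ⟨_, rfl⟩
  have hW2 : ∀ (X : ModuleCat.{u} A) [Module.Finite A X] [Module.Injective A X],
      (∀ S : Submodule A X, IsSimpleModule A S → ∃ g : S →ₗ[A] T, g ≠ 0) → χ X ∈ W := by
    intro X _ _ h
    have hne : Module.length A X ≠ ⊤ := by
      rw [Module.length_ne_top_iff, isFiniteLength_iff_isNoetherian_isArtinian]
      exact ⟨inferInstance, inferInstance⟩
    exact inj_chi W (by omega) hχ hT hW (Module.length A X).toNat X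
      (by rw [ENat.natCast_toNat hne]) h
  have hsingle : ∀ i, Pi.single i (1 : ℚ) ∈ W := by
    intro i
    have := hM i
    obtain ⟨e, he, ⟨p, hp⟩, huniq⟩ := exists_proj (A := A) (A ⧸ M i)
    have hfix : ∀ x : LinearMap.range e, e.rangeRestrict x = x := by
      rintro ⟨_, y, rfl⟩; exact Subtype.ext (he y)
    have hproj : Module.Projective A (LinearMap.range e) :=
      Module.Projective.of_split (LinearMap.range e).subtype e.rangeRestrict
        (LinearMap.ext hfix)
    let X := ModuleCat.of A (LinearMap.range e)
    have hXp : Module.Projective A X := hproj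
    have hXf : Module.Finite A X := inferInstanceAs (Module.Finite A (LinearMap.range e))
    have hX : FP 0 X := fp_zero X
    have h1 : χ X ∈ W := by
      refine chi_d W hχ hT hW2 d b X le_rfl le_rfl (hX.mono (Nat.zero_le b)) ?_ ?_
      · exact id_of_retract (Y := ModuleCat.of A A) (LinearMap.range e).subtype e.rangeRestrict
          hfix hid
      · intro S hS h0
        exact orth_of_retract (Y := ModuleCat.of A A) (LinearMap.range e).subtype e.rangeRestrict
          hfix (horth S hS h0)
    rw [hχl X hX] at h1
    have h2 : l X = (len R₀ (A ⧸ M i) X) • Pi.single i (1 : ℚ) := by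
      funext k
      by_cases hk : k = i
      · subst hk; simp [l]
      · rw [Pi.smul_apply, Pi.single_eq_of_ne hk, smul_zero]
        apply len_zero
        intro f
        by_contra hf
        have := hM k
        exact hk (hMinj k i (huniq _ f hf))
    have h3 := len_ne R₀ (A ⧸ M i) X p hp
    rw [h2] at h1
    exact (Submodule.smul_mem_iff W h3).1 h1
  have h1 : Fintype.card ι ≤ Fintype.card {i // P i} := card_le_of_span (fun i => χ (E i)) hsingle
  obtain ⟨k, ⟨e⟩⟩ := hMall S
  have hk : ¬ P k := by
    rintro ⟨g, hg⟩
    apply hg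
    have := hcon (g ∘ₗ e.toLinearMap)
    ext x
    have := DFunLike.congr_fun this (e.symm (Submodule.Quotient.mk 1))
    simpa using this
  exact absurd h1 (not_le.2 (Fintype.card_subtype_lt hk))

end Tilt

namespace Tilt

theorem id_zero {A : Type u} [Ring A] (X : ModuleCat.{u} A) [Subsingleton X] :
    HasInjectiveDimensionLT X (0+1) := by
  have : Module.Injective A X := ⟨fun P Q _ _ _ _ i hi φ => ⟨0, fun x => Subsingleton.elim _ _⟩⟩
  have : Injective X := Module.injective_object_of_injective_module A X
  exact injective_iff_hasInjectiveDimensionLT_one.1 this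

theorem id_inj {A : Type u} [Ring A] (X : ModuleCat.{u} A) [Module.Injective A X] (d : ℕ) :
    HasInjectiveDimensionLT X (d+1) := by
  have : Injective X := Module.injective_object_of_injective_module A X
  have : HasInjectiveDimensionLT X 1 := injective_iff_hasInjectiveDimensionLT_one.1 this
  exact hasInjectiveDimensionLT_of_ge X 1 (d+1) (by omega)

theorem main (R₀ : Type u) [CommRing R₀] [IsArtinianRing R₀]
    (A : Type u) [Ring A] [Algebra R₀ A] [Module.Finite R₀ A]
    (m : ℕ)
    (K : Fin (m + 3) → ModuleCat.{u} A) (Is : Fin (m + 2) → ModuleCat.{u} A)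
    (f : ∀ i : Fin (m + 2), ↥(K i.castSucc) →ₗ[A] ↥(Is i))
    (g : ∀ i : Fin (m + 2), ↥(Is i) →ₗ[A] ↥(K i.succ))
    (hK0 : Nonempty (A ≃ₗ[A] K 0)) (hKlast : Subsingleton (K (Fin.last (m + 2))))
    (hhull : ∀ i, IsInjHull A (f i))
    (hepi : ∀ i, Function.Surjective (g i))
    (hexact : ∀ i, Function.Exact (f i) (g i))
    (hpd : ∀ i : Fin (m + 1), projDim A (Is i.castSucc) ≤ (1 : ℕ∞)) :
    ∀ J : ModuleCat.{u} A, Module.Finite A J → Module.Injective A J →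
      InAdd A (∀ i : Fin (m + 2), ↥(Is i)) J := by
  have hAa : IsArtinianRing A := IsArtinianRing.of_finite R₀ A
  have hAn : IsNoetherianRing A := IsNoetherianRing.of_finite R₀ A
  obtain ⟨e0⟩ := hK0
  have hses : ∀ i, SES (f i) (g i) := fun i => ⟨(hhull i).2.1, hexact i, hepi i⟩
  have hIi : ∀ i, Module.Injective A (Is i) := fun i => (hhull i).1
  have hKf : ∀ i, Module.Finite A (K i) := by
    intro i
    induction i using Fin.induction with
    | zero => exact Module.Finite.equiv e0
    | succ i ih =>
      have := hull_finite R₀ A (f i) (hhull i)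
      exact Module.Finite.of_surjective (g i) (hepi i)
  have hIf : ∀ i, Module.Finite A (Is i) := fun i => by
    have := hKf i.castSucc
    exact hull_finite R₀ A (f i) (hhull i)
  have hKpd : ∀ i : Fin (m + 3), i.1 ≤ m + 1 → HasProjectiveDimensionLT (K i) (i.1 + 1) := by
    intro i
    induction i using Fin.induction with
    | zero =>
      intro _
      have h := (fp_zero (ModuleCat.of A A)).2
      exact pd_of_retract (Y := ModuleCat.of A A) e0.symm.toLinearMap e0.toLinearMap
        (fun x => by simp) h
    | succ i ih =>
      intro hi
      have hi' : i.1 ≤ m := by simpa using hi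
      have h1 : HasProjectiveDimensionLT (Is i) 2 := pd_of_projDim A _ (hpd ⟨i.1, by omega⟩)
      have h2 := ih (by simp; omega)
      exact (hses i).pd3 h2 (hasProjectiveDimensionLT_of_ge _ 2 _ (by simp))
  have hIfp : ∀ i, FP (m + 1) (Is i) := by
    intro i
    refine ⟨hIf i, ?_⟩
    by_cases hi : i.1 ≤ m
    · have h1 : HasProjectiveDimensionLT (Is i) 2 := pd_of_projDim A _ (hpd ⟨i.1, by omega⟩)
      exact hasProjectiveDimensionLT_of_ge _ 2 _ (by omega)
    · have hi2 : i = Fin.last (m+1) := Fin.ext (by simp; omega)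
      subst hi2
      have h2 := hKpd (Fin.last (m+1)).castSucc (by simp)
      have : Subsingleton (K (Fin.last (m+1)).succ) := hKlast
      exact (hses (Fin.last (m+1))).pd2 h2 (zero_fp (m+1) _).2
  let T := ModuleCat.of A (∀ i : Fin (m + 2), Is i)
  have hT : FP (m+1) T := pi_fp (m+1) _ Is hIfp
  have hTi : Module.Injective A T := inferInstanceAs (Module.Injective A (∀ i : Fin (m + 2), Is i))
  have hKid : ∀ i : Fin (m+3), ∃ d, HasInjectiveDimensionLT (K i) (d+1) := by
    intro i
    induction i using Fin.reverseInduction with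
    | last => exact ⟨0, id_zero _⟩
    | cast i ih =>
      obtain ⟨d, hd⟩ := ih
      exact ⟨d+1, (hses i).id1 hd (id_inj _ _)⟩
  have hKo : ∀ S : ModuleCat.{u} A, (∀ h : S →ₗ[A] T, h = 0) → ∀ i : Fin (m+3), Orth S (K i) := by
    intro S h0 i
    induction i using Fin.reverseInduction with
    | last =>
      have : Module.Injective A (K (Fin.last (m+2))) :=
        ⟨fun P Q _ _ _ _ i hi φ => ⟨0, fun x => Subsingleton.elim _ _⟩⟩
      exact orth_of_inj fun h => LinearMap.ext fun x => Subsingleton.elim _ _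
    | cast i ih =>
      refine (hses i).orth1 (orth_of_inj fun h => LinearMap.ext fun x => ?_) ih
      have := DFunLike.congr_fun (h0 ((LinearMap.single A (fun i => Is i) i) ∘ₗ h)) x
      have h2 := congrFun this i
      change Pi.single (M := fun i => Is i) i (h x) i = 0 at h2
      rw [Pi.single_eq_same] at h2
      exact h2
  obtain ⟨d, hd⟩ := hKid 0
  have hcore := core R₀ A (b := m+1) (d := d) T hT
    (id_of_retract (Y := K 0) e0.toLinearMap e0.symm.toLinearMap (fun x => by simp) hd)
    (fun S _ h0 => orth_of_retract (Y := K 0) e0.toLinearMap e0.symm.toLinearMap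
      (fun x => by simp) (hKo S h0 0))
  intro J hJf hJi
  obtain ⟨n, s, hs⟩ := embed (X := J) (T := ∀ i : Fin (m + 2), Is i) (fun S _ => hcore S)
  obtain ⟨r, hr⟩ := split_inj s hs
  have hrs : Function.Surjective r := fun x => ⟨_, hr x⟩
  have hex : Function.Exact (LinearMap.ker r).subtype r := LinearMap.exact_subtype_ker_map r
  have hex2 := hex.splitSurjectiveEquiv Subtype.val_injective ⟨s, LinearMap.ext hr⟩
  exact ⟨n, ModuleCat.of A (LinearMap.ker r),
    ⟨(LinearEquiv.prodComm A _ _).trans hex2.1.symm⟩⟩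

end Tilt

/-- Let `A` be an artin algebra with `id A = m + 1` and minimal injective
coresolution `0 → A → I⁰ → ⋯ → I^{m+1} → 0` in which `I⁰, …, I^m` have projective dimension
at most `1`. Then every (finitely generated) injective `A`-module is a direct summand of a
finite direct sum of copies of `I⁰ ⊕ ⋯ ⊕ I^{m+1}`. -/
theorem stmt12 (R₀ : Type u) [CommRing R₀] [IsArtinianRing R₀]
    (A : Type u) [Ring A] [Algebra R₀ A] [Module.Finite R₀ A]
    (m : ℕ) (hid : injDim A A = ((m : ℕ∞) + 1))
    (K : Fin (m + 3) → ModuleCat.{u} A) (Is : Fin (m + 2) → ModuleCat.{u} A)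
    (f : ∀ i : Fin (m + 2), ↥(K i.castSucc) →ₗ[A] ↥(Is i))
    (g : ∀ i : Fin (m + 2), ↥(Is i) →ₗ[A] ↥(K i.succ))
    (hK0 : Nonempty (A ≃ₗ[A] K 0)) (hKlast : Subsingleton (K (Fin.last (m + 2))))
    (hhull : ∀ i, IsInjHull A (f i))
    (hepi : ∀ i, Function.Surjective (g i))
    (hexact : ∀ i, Function.Exact (f i) (g i))
    (hpd : ∀ i : Fin (m + 1), projDim A (Is i.castSucc) ≤ (1 : ℕ∞)) :
    ∀ J : ModuleCat.{u} A, Module.Finite A J → Module.Injective A J →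
      InAdd A (∀ i : Fin (m + 2), ↥(Is i)) J := by
  exact Tilt.main R₀ A m K Is f g hK0 hKlast hhull hepi hexact hpd
end
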